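/- Let J be a closed ideal of the Banach algebra D(μ) ∩ H^∞ that contains an outer function, and suppose Z̲(J) := ⋂_{f ∈ J} Z̲(f) = {ζ₀} for some ζ₀ ∈ 𝕋. Then the function z − ζ₀ belongs to J. -/

import Mathlib

open MeasureTheory Metric Filter Complex Set
open scoped ENNReal Topology

noncomputable section

namespace DirichletMu

/-- The open unit disc in `ℂ`. -/
def disc : Set ℂ := Metric.ball 0 1

/-- The unit circle `𝕋`. -/
def circleT : Set ℂ := Metric.sphere 0 1

/-- The boundary point `e^{it}`. -/
def bpt (t : ℝ) : ℂ := Complex.exp (Complex.I * (t : ℂ))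

/-- Arc-length parametrizing measure on `(0, 2π]`. -/
def θm : Measure ℝ := volume.restrict (Set.Ioc 0 (2 * Real.pi))

/-- A measure is carried by the unit circle. -/
def OnCircle (μ : Measure ℂ) : Prop := μ circleTᶜ = 0

/-- The mean-square integrals of `f` over circles of radius `r < 1`. -/
def hardySet (f : ℂ → ℂ) : Set ℝ :=
  {x | ∃ r : ℝ, 0 < r ∧ r < 1 ∧
    x = (1 / (2 * Real.pi)) * ∫ t in (0:ℝ)..(2 * Real.pi), ‖f ((r : ℂ) * bpt t)‖ ^ 2}

/-- Membership in the Hardy space `H²`. -/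
def MemHardy2 (f : ℂ → ℂ) : Prop :=
  DifferentiableOn ℂ f disc ∧ BddAbove (hardySet f)

/-- The squared Hardy norm. -/
def hardyNormSq (f : ℂ → ℂ) : ℝ := sSup (hardySet f)

/-- Membership in `H^∞`. -/
def MemHinf (f : ℂ → ℂ) : Prop :=
  DifferentiableOn ℂ f disc ∧ ∃ C : ℝ, ∀ z ∈ disc, ‖f z‖ ≤ C

/-- The sup norm over the disc. -/
def supNorm (f : ℂ → ℂ) : ℝ := sSup ((fun z => ‖f z‖) '' disc)

/-- The Poisson integral of the measure `μ`. -/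
def poissonMu (μ : Measure ℂ) (z : ℂ) : ℝ :=
  ∫ ζ, (1 - ‖z‖ ^ 2) / ‖1 - (starRingEnd ℂ) ζ * z‖ ^ 2 ∂μ

/-- The integrand of the Dirichlet integral. -/
def dirichletDensity (μ : Measure ℂ) (f : ℂ → ℂ) (z : ℂ) : ℝ :=
  ‖deriv f z‖ ^ 2 * poissonMu μ z

/-- The Dirichlet integral `D_μ(f)`. -/
def dirichletIntegral (μ : Measure ℂ) (f : ℂ → ℂ) : ℝ :=
  (1 / Real.pi) * ∫ z in disc, dirichletDensity μ f z

/-- Membership in the Dirichlet-type space `D(μ)`. -/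
def MemD (μ : Measure ℂ) (f : ℂ → ℂ) : Prop :=
  MemHardy2 f ∧ IntegrableOn (dirichletDensity μ f) disc

/-- The squared norm `‖f‖_μ²` of `D(μ)`. -/
def dNormSq (μ : Measure ℂ) (f : ℂ → ℂ) : ℝ :=
  hardyNormSq f + dirichletIntegral μ f

/-- `f` has radial limit `L` at `ζ`. -/
def HasRadialLimitAt (f : ℂ → ℂ) (ζ L : ℂ) : Prop :=
  Tendsto (fun r : ℝ => f ((r : ℂ) * ζ)) (nhdsWithin 1 (Set.Iio 1)) (nhds L)

/-- The modulus of `f` has radial limit `m` at `e^{it}`. -/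
def BoundaryAbs (f : ℂ → ℂ) (t : ℝ) (m : ℝ) : Prop :=
  Tendsto (fun r : ℝ => ‖f ((r : ℂ) * bpt t)‖) (nhdsWithin 1 (Set.Iio 1)) (nhds m)

/-- The boundary zero set `Z_𝕋(f)`. -/
def ZT (f : ℂ → ℂ) : Set ℂ :=
  {ζ | ζ ∈ circleT ∧ HasRadialLimitAt f ζ 0}

/-- The set `Z̲(f)`. -/
def Zlow (f : ℂ → ℂ) : Set ℂ :=
  {ζ | ζ ∈ Metric.closedBall (0 : ℂ) 1 ∧
    Filter.liminf (fun z => ‖f z‖) (nhdsWithin ζ disc) = 0}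

def ZlowSet (S : Set (ℂ → ℂ)) : Set ℂ := ⋂ f ∈ S, Zlow f

def ZTSet (S : Set (ℂ → ℂ)) : Set ℂ := ⋂ f ∈ S, ZT f

/-- `[f]_{D(μ)}`: the closure in `D(μ)` of the polynomial multiples of `f`. -/
def closedSpan (μ : Measure ℂ) (f : ℂ → ℂ) : Set (ℂ → ℂ) :=
  {g | MemD μ g ∧ ∀ ε > 0, ∃ q : Polynomial ℂ,
    dNormSq μ (fun z => g z - q.eval z * f z) < ε}

/-- `f` is cyclic for `D(μ)`. -/
def IsCyclic (μ : Measure ℂ) (f : ℂ → ℂ) : Prop :=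
  closedSpan μ f = {g | MemD μ g}

/-- `f` is the outer function with boundary modulus `φ` (parametrized by `e^{it}`). -/
def OuterWith (f : ℂ → ℂ) (φ : ℝ → ℝ) : Prop :=
  (∀ t, 0 ≤ φ t) ∧
  IntervalIntegrable (fun t => Real.log (φ t)) volume 0 (2 * Real.pi) ∧
  ∀ z ∈ disc, f z = Complex.exp (((2 * Real.pi : ℝ) : ℂ)⁻¹ *
    ∫ t in (0:ℝ)..(2 * Real.pi), ((bpt t + z) / (bpt t - z)) * (Real.log (φ t) : ℂ))

/-- `f` is an outer function. -/
def IsOuter (f : ℂ → ℂ) : Prop := ∃ φ, OuterWith f φ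

/-- Inner functions. -/
def IsInner (f : ℂ → ℂ) : Prop :=
  DifferentiableOn ℂ f disc ∧ (∀ z ∈ disc, ‖f z‖ ≤ 1) ∧
  ∀ᵐ t ∂θm, BoundaryAbs f t 1

/-- `f / Θ ∈ H²`. -/
def InnerDivides (Θ f : ℂ → ℂ) : Prop :=
  ∃ g, MemHardy2 g ∧ ∀ z ∈ disc, f z = Θ z * g z

/-- `Θ / Θ'` is bounded on the disc. -/
def DividesBdd (Θ' Θ : ℂ → ℂ) : Prop :=
  ∃ g, MemHinf g ∧ ∀ z ∈ disc, Θ z = Θ' z * g z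

/-- `Θ` is the greatest common inner divisor of the family `M`. -/
def IsGCDInner (M : Set (ℂ → ℂ)) (Θ : ℂ → ℂ) : Prop :=
  IsInner Θ ∧ (∀ f ∈ M, InnerDivides Θ f) ∧
  ∀ Θ', IsInner Θ' → (∀ f ∈ M, InnerDivides Θ' f) → DividesBdd Θ' Θ

/-- The set `Θ H²`. -/
def innerMulH2 (Θ : ℂ → ℂ) : Set (ℂ → ℂ) :=
  {h | ∃ g, MemHardy2 g ∧ ∀ z ∈ disc, h z = Θ z * g z}

/-- Poisson extension of a boundary function (parametrized by `e^{it}`). -/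
def poissonExt (u : ℝ → ℝ) (z : ℂ) : ℝ :=
  (1 / (2 * Real.pi)) * ∫ t in (0:ℝ)..(2 * Real.pi),
    ((1 - ‖z‖ ^ 2) / ‖bpt t - z‖ ^ 2) * u t

/-- `|∇ P[u]|² P_μ`. -/
def gradDensity (μ : Measure ℂ) (u : ℝ → ℝ) (z : ℂ) : ℝ :=
  ‖fderiv ℝ (poissonExt u) z‖ ^ 2 * poissonMu μ z

/-- Membership in the harmonic Dirichlet space `D^h(μ)`. -/
def MemDh (μ : Measure ℂ) (u : ℝ → ℝ) : Prop :=
  IntegrableOn (fun t => (u t) ^ 2) (Set.Ioc 0 (2 * Real.pi)) volume ∧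
  IntegrableOn (gradDensity μ u) disc

/-- The squared norm of `D^h(μ)`. -/
def dhNormSq (μ : Measure ℂ) (u : ℝ → ℝ) : ℝ :=
  (1 / (2 * Real.pi)) * (∫ t in Set.Ioc 0 (2 * Real.pi), (u t) ^ 2) +
  (1 / Real.pi) * ∫ z in disc, gradDensity μ u z

/-- Relatively open subsets of the circle. -/
def RelOpen (U : Set ℂ) : Prop := ∃ V : Set ℂ, IsOpen V ∧ U = V ∩ circleT

/-- Capacity of a relatively open subset of the circle. -/
def capOpen (μ : Measure ℂ) (U : Set ℂ) : ℝ≥0∞ :=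
  ⨅ (u : ℝ → ℝ) (_ : MemDh μ u ∧ (∀ t, 0 ≤ u t) ∧
      ∀ᵐ t ∂θm, bpt t ∈ U → 1 ≤ u t),
    ENNReal.ofReal (dhNormSq μ u)

/-- The capacity `c_μ` of an arbitrary subset of the circle. -/
def cap (μ : Measure ℂ) (F : Set ℂ) : ℝ≥0∞ :=
  ⨅ (U : Set ℂ) (_ : RelOpen U ∧ F ⊆ U), capOpen μ U

/-- The (closed) support of a measure on `ℂ`. -/
def msupport (μ : Measure ℂ) : Set ℂ :=
  {x | ∀ r > 0, 0 < μ (Metric.ball x r)}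

/-- `M_μ(E)`: functions of `D(μ)` whose radial limits vanish `c_μ`-q.e. on `E`. -/
def Mspace (μ : Measure ℂ) (E : Set ℂ) : Set (ℂ → ℂ) :=
  {g | MemD μ g ∧ ∃ N : Set ℂ, cap μ N = 0 ∧ ∀ ζ ∈ E \ N, HasRadialLimitAt g ζ 0}

/-- Closed shift-invariant subspaces of `D(μ)` (closedness for the `D(μ)` norm). -/
structure ClosedInvSubspace (μ : Measure ℂ) (M : Set (ℂ → ℂ)) : Prop where
  subset : M ⊆ {f | MemD μ f}
  zero_mem : (fun _ => (0 : ℂ)) ∈ M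
  add_mem : ∀ f ∈ M, ∀ g ∈ M, (fun z => f z + g z) ∈ M
  smul_mem : ∀ (c : ℂ), ∀ f ∈ M, (fun z => c * f z) ∈ M
  shift_mem : ∀ f ∈ M, (fun z => z * f z) ∈ M
  closed : ∀ g, MemD μ g →
    (∀ ε > 0, ∃ h ∈ M, dNormSq μ (fun z => g z - h z) < ε) → g ∈ M

/-- The norm `‖f‖_{∞,μ}` of the Banach algebra `D(μ) ∩ H^∞`. -/
def algNorm (μ : Measure ℂ) (f : ℂ → ℂ) : ℝ :=
  supNorm f + Real.sqrt (dirichletIntegral μ f)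

/-- Membership in the Banach algebra `D(μ) ∩ H^∞`. -/
def MemA (μ : Measure ℂ) (f : ℂ → ℂ) : Prop := MemD μ f ∧ MemHinf f

/-- Closed ideals of `D(μ) ∩ H^∞`. -/
structure ClosedIdeal (μ : Measure ℂ) (J : Set (ℂ → ℂ)) : Prop where
  subset : J ⊆ {f | MemA μ f}
  zero_mem : (fun _ => (0 : ℂ)) ∈ J
  add_mem : ∀ f ∈ J, ∀ g ∈ J, (fun z => f z + g z) ∈ J
  mul_mem : ∀ f, MemA μ f → ∀ g ∈ J, (fun z => f z * g z) ∈ J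
  closed : ∀ g, MemA μ g →
    (∀ ε > 0, ∃ h ∈ J, algNorm μ (fun z => g z - h z) < ε) → g ∈ J

/-- A multiplier of `D(μ)`. -/
def IsMultiplier (μ : Measure ℂ) (φ : ℂ → ℂ) : Prop :=
  DifferentiableOn ℂ φ disc ∧ ∀ g, MemD μ g → MemD μ (fun z => φ z * g z)

/-- Distance between two subsets of `ℂ`. -/
def setDist (A B : Set ℂ) : ℝ :=
  sInf ((fun p : ℂ × ℂ => dist p.1 p.2) '' (A ×ˢ B))

theorem poissonMu_nonneg (μ : Measure ℂ) {z : ℂ} (hz : z ∈ disc) : 0 ≤ poissonMu μ z := by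
  have hz' : ‖z‖ < 1 := by simpa [disc] using hz
  refine integral_nonneg fun ζ => div_nonneg ?_ (by positivity)
  simp only [sub_nonneg]
  exact pow_le_one₀ (norm_nonneg _) hz'.le

theorem norm_one_sub_conj_mul {ζ : ℂ} (hζ : ‖ζ‖ = 1) (z : ℂ) :
    ‖1 - (starRingEnd ℂ) ζ * z‖ = ‖z - ζ‖ := by
  have h : (starRingEnd ℂ) ζ * ζ = 1 := by
    rw [mul_comm, Complex.mul_conj, Complex.normSq_eq_norm_sq, hζ]; simp
  rw [← h, ← mul_sub, norm_mul, RCLike.norm_conj, hζ, one_mul, norm_sub_rev]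

theorem integrableOn_ball_inv_norm : IntegrableOn (fun z : ℂ => ‖z‖⁻¹) (ball 0 2) := by
  refine integrableOn_ball_of_norm_le_rpow (C := 1) (α := 1) (by simp) (by simp) ?_ (by fun_prop)
  refine Eventually.of_forall fun z => ?_
  simp [Real.rpow_neg_one]

theorem poissonKernel_le {ζ z : ℂ} (hζ : ‖ζ‖ = 1) (hz : ‖z‖ < 1) :
    (1 - ‖z‖ ^ 2) / ‖1 - (starRingEnd ℂ) ζ * z‖ ^ 2 ≤ 2 * ‖z - ζ‖⁻¹ := by
  rw [norm_one_sub_conj_mul hζ]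
  have h1 : 1 - ‖z‖ ≤ ‖z - ζ‖ := by
    have := norm_sub_norm_le ζ z
    rw [norm_sub_rev, hζ] at this; exact this
  have h2 : 0 < ‖z - ζ‖ := by linarith
  have h3 : 2 * ‖z - ζ‖⁻¹ = (2 * ‖z - ζ‖) / ‖z - ζ‖ ^ 2 := by field_simp
  rw [h3]
  gcongr
  nlinarith [norm_nonneg z]

theorem integrable_poissonKernel (μ : Measure ℂ) [IsFiniteMeasure μ] (hμ : OnCircle μ) :
    Integrable (fun p : ℂ × ℂ => (1 - ‖p.1‖ ^ 2) / ‖1 - (starRingEnd ℂ) p.2 * p.1‖ ^ 2)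
      ((volume.restrict disc).prod μ) := by
  have hmeas : Measurable
      (fun p : ℂ × ℂ => (1 - ‖p.1‖ ^ 2) / ‖1 - (starRingEnd ℂ) p.2 * p.1‖ ^ 2) := by
    have : Measurable (starRingEnd ℂ) := Complex.continuous_conj.measurable
    fun_prop
  have hcirc : ∀ᵐ ζ ∂μ, ‖ζ‖ = 1 := by
    filter_upwards [compl_mem_ae_iff.mpr hμ] with ζ hζ
    simpa [circleT] using hζ
  have hshift : ∀ ζ : ℂ, IntegrableOn (fun z : ℂ => ‖z - ζ‖⁻¹) (ball ζ 2) ∧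
      ∫ z in ball ζ 2, ‖z - ζ‖⁻¹ = ∫ z in ball (0 : ℂ) 2, ‖z‖⁻¹ := by
    intro ζ
    have hp := measurePreserving_sub_right (volume : Measure ℂ) ζ
    have he : MeasurableEmbedding (fun z : ℂ => z - ζ) := measurableEmbedding_subRight ζ
    have hpre : (fun z : ℂ => z - ζ) ⁻¹' ball 0 2 = ball ζ 2 := by
      ext z; simp [dist_eq_norm]
    refine ⟨?_, ?_⟩
    · have := (hp.integrableOn_comp_preimage he (f := fun z : ℂ => ‖z‖⁻¹) (s := ball 0 2)).mpr
        integrableOn_ball_inv_norm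
      rwa [hpre] at this
    · have := hp.setIntegral_preimage_emb he (fun z : ℂ => ‖z‖⁻¹) (ball 0 2)
      rwa [hpre] at this
  have hsub : ∀ ζ : ℂ, ‖ζ‖ = 1 → disc ⊆ ball ζ 2 := by
    intro ζ hζ z hz
    have hz' : ‖z‖ < 1 := by simpa [disc] using hz
    rw [mem_ball, dist_eq_norm]
    linarith [norm_sub_le z ζ]
  have hbd : ∀ ζ : ℂ, ‖ζ‖ = 1 → IntegrableOn (fun z : ℂ => 2 * ‖z - ζ‖⁻¹) disc := fun ζ hζ =>
    ((hshift ζ).1.mono_set (hsub ζ hζ)).const_mul 2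
  have hnb : ∀ ζ : ℂ, ‖ζ‖ = 1 → ∀ᵐ z ∂(volume.restrict disc),
      ‖(1 - ‖z‖ ^ 2) / ‖1 - (starRingEnd ℂ) ζ * z‖ ^ 2‖ ≤ 2 * ‖z - ζ‖⁻¹ := by
    intro ζ hζ
    filter_upwards [ae_restrict_mem (measurableSet_ball : MeasurableSet disc)] with z hz
    have hz' : ‖z‖ < 1 := by simpa [disc] using hz
    rw [Real.norm_of_nonneg]
    · exact poissonKernel_le hζ hz'
    · exact div_nonneg (by nlinarith [norm_nonneg z]) (by positivity)
  have hint : ∀ ζ : ℂ, ‖ζ‖ = 1 → Integrable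
      (fun z : ℂ => (1 - ‖z‖ ^ 2) / ‖1 - (starRingEnd ℂ) ζ * z‖ ^ 2) (volume.restrict disc) :=
    fun ζ hζ => Integrable.mono' (hbd ζ hζ)
      (hmeas.comp (measurable_id.prodMk measurable_const)).aestronglyMeasurable (hnb ζ hζ)
  rw [integrable_prod_iff' hmeas.aestronglyMeasurable]
  refine ⟨hcirc.mono hint, ?_⟩
  refine Integrable.mono' (integrable_const (2 * ∫ z in ball (0 : ℂ) 2, ‖z‖⁻¹)) ?_ ?_
  · exact (hmeas.comp measurable_swap).norm.stronglyMeasurable.integral_prod_right'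
      |>.aestronglyMeasurable
  · filter_upwards [hcirc] with ζ hζ
    rw [Real.norm_of_nonneg (integral_nonneg fun z => norm_nonneg _)]
    calc ∫ z in disc, ‖(1 - ‖z‖ ^ 2) / ‖1 - (starRingEnd ℂ) ζ * z‖ ^ 2‖
        ≤ ∫ z in disc, 2 * ‖z - ζ‖⁻¹ :=
          integral_mono_ae (hint ζ hζ).norm (hbd ζ hζ) (hnb ζ hζ)
      _ ≤ ∫ z in ball ζ 2, 2 * ‖z - ζ‖⁻¹ :=
          setIntegral_mono_set ((hshift ζ).1.const_mul 2)
            (Eventually.of_forall fun z => by positivity) (hsub ζ hζ).eventuallyLE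
      _ = _ := by rw [integral_const_mul, (hshift ζ).2]

theorem integrableOn_poissonMu (μ : Measure ℂ) [IsFiniteMeasure μ] (hμ : OnCircle μ) :
    IntegrableOn (poissonMu μ) disc :=
  (integrable_poissonKernel μ hμ).integral_prod_left

theorem sqrt_le_add_of_forall {X A B : ℝ} (hA : 0 ≤ A) (hB : 0 ≤ B)
    (h : ∀ t : ℝ, 0 < t → X ≤ (1 + t) * A + (1 + t⁻¹) * B) : √X ≤ √A + √B := by
  refine le_of_forall_pos_le_add fun ε hε => ?_
  set a := √A + ε / 2 with ha
  set b := √B + ε / 2 with hb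
  have ha0 : 0 < a := by positivity
  have hb0 : 0 < b := by positivity
  have hAa : A ≤ a ^ 2 := by
    nlinarith [Real.sq_sqrt hA, Real.sqrt_nonneg A]
  have hBb : B ≤ b ^ 2 := by
    nlinarith [Real.sq_sqrt hB, Real.sqrt_nonneg B]
  have h1 := h (b / a) (by positivity)
  have h2 : X ≤ (a + b) ^ 2 := by
    calc X ≤ (1 + b / a) * A + (1 + (b / a)⁻¹) * B := h1
      _ ≤ (1 + b / a) * a ^ 2 + (1 + (b / a)⁻¹) * b ^ 2 := by gcongr
      _ = (a + b) ^ 2 := by field_simp; ring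
  calc √X ≤ √((a + b) ^ 2) := Real.sqrt_le_sqrt h2
    _ = a + b := Real.sqrt_sq (by positivity)
    _ = √A + √B + ε := by rw [ha, hb]; ring

theorem isOpen_disc : IsOpen disc := isOpen_ball

theorem mem_disc {z : ℂ} : z ∈ disc ↔ ‖z‖ < 1 := by simp [disc]

theorem differentiableAt_of_disc {f : ℂ → ℂ} (hf : DifferentiableOn ℂ f disc) {z : ℂ}
    (hz : z ∈ disc) : DifferentiableAt ℂ f z :=
  hf.differentiableAt (isOpen_disc.mem_nhds hz)

theorem dirichletDensity_nonneg (μ : Measure ℂ) (f : ℂ → ℂ) {z : ℂ} (hz : z ∈ disc) :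
    0 ≤ dirichletDensity μ f z :=
  mul_nonneg (by positivity) (poissonMu_nonneg μ hz)

theorem dirichletIntegral_nonneg (μ : Measure ℂ) (f : ℂ → ℂ) : 0 ≤ dirichletIntegral μ f :=
  mul_nonneg (by positivity)
    (setIntegral_nonneg measurableSet_ball fun _ hz => dirichletDensity_nonneg μ f hz)

section Core

variable {μ : Measure ℂ}

theorem aestronglyMeasurable_dirichletDensity [IsFiniteMeasure μ] (hμ : OnCircle μ) (f : ℂ → ℂ) :
    AEStronglyMeasurable (dirichletDensity μ f) (volume.restrict disc) :=
  ((measurable_deriv f).norm.pow_const 2).aestronglyMeasurable.mul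
    (integrableOn_poissonMu μ hμ).aestronglyMeasurable

theorem dirichlet_dominated [IsFiniteMeasure μ] (hμ : OnCircle μ) {f g F : ℂ → ℂ} {α β : ℝ}
    (hα : 0 ≤ α) (hβ : 0 ≤ β)
    (hf : IntegrableOn (dirichletDensity μ f) disc)
    (hg : IntegrableOn (dirichletDensity μ g) disc)
    (h : ∀ z ∈ disc, ‖deriv F z‖ ≤ α * ‖deriv f z‖ + β * ‖deriv g z‖) :
    IntegrableOn (dirichletDensity μ F) disc ∧
      √(dirichletIntegral μ F) ≤ α * √(dirichletIntegral μ f) + β * √(dirichletIntegral μ g) := by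
  have hpt : ∀ t : ℝ, 0 < t → ∀ z ∈ disc, dirichletDensity μ F z ≤
      ((1 + t) * α ^ 2) * dirichletDensity μ f z
        + ((1 + t⁻¹) * β ^ 2) * dirichletDensity μ g z := by
    intro t ht z hz
    have h1 : ‖deriv F z‖ ^ 2 ≤ ((1 + t) * α ^ 2) * ‖deriv f z‖ ^ 2
        + ((1 + t⁻¹) * β ^ 2) * ‖deriv g z‖ ^ 2 := by
      have h0 := pow_le_pow_left₀ (norm_nonneg _) (h z hz) 2
      refine h0.trans ?_
      have hk : 0 ≤ t⁻¹ * (t * (α * ‖deriv f z‖) - β * ‖deriv g z‖) ^ 2 := by positivity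
      have he : t⁻¹ * (t * (α * ‖deriv f z‖) - β * ‖deriv g z‖) ^ 2 =
          t * (α * ‖deriv f z‖) ^ 2 - 2 * (α * ‖deriv f z‖) * (β * ‖deriv g z‖)
            + t⁻¹ * (β * ‖deriv g z‖) ^ 2 := by field_simp; ring
      nlinarith
    have := mul_le_mul_of_nonneg_right h1 (poissonMu_nonneg μ hz)
    simp only [dirichletDensity]
    linarith
  have hint : ∀ t : ℝ, IntegrableOn (fun z => ((1 + t) * α ^ 2) * dirichletDensity μ f z
        + ((1 + t⁻¹) * β ^ 2) * dirichletDensity μ g z) disc := fun t =>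
    (hf.const_mul _).add (hg.const_mul _)
  have hF : IntegrableOn (dirichletDensity μ F) disc := by
    refine Integrable.mono' (hint 1) (aestronglyMeasurable_dirichletDensity hμ F) ?_
    filter_upwards [ae_restrict_mem (measurableSet_ball : MeasurableSet disc)] with z hz
    rw [Real.norm_of_nonneg (dirichletDensity_nonneg μ F hz)]
    exact hpt 1 one_pos z hz
  refine ⟨hF, ?_⟩
  have key : √(dirichletIntegral μ F) ≤
      √(α ^ 2 * dirichletIntegral μ f) + √(β ^ 2 * dirichletIntegral μ g) := by
    refine sqrt_le_add_of_forall (mul_nonneg (sq_nonneg _) (dirichletIntegral_nonneg μ f))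
      (mul_nonneg (sq_nonneg _) (dirichletIntegral_nonneg μ g)) fun t ht => ?_
    have h1 : ∫ z in disc, dirichletDensity μ F z ≤
        ((1 + t) * α ^ 2) * (∫ z in disc, dirichletDensity μ f z)
          + ((1 + t⁻¹) * β ^ 2) * (∫ z in disc, dirichletDensity μ g z) := by
      rw [← integral_const_mul, ← integral_const_mul]
      refine (setIntegral_mono_on hF (hint t) measurableSet_ball (hpt t ht)).trans_eq ?_
      exact integral_add (hf.const_mul _) (hg.const_mul _)
    have h2 := mul_le_mul_of_nonneg_left h1 (by positivity : 0 ≤ 1 / Real.pi)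
    simp only [dirichletIntegral]
    linarith
  rwa [Real.sqrt_mul (sq_nonneg _), Real.sqrt_mul (sq_nonneg _), Real.sqrt_sq hα,
    Real.sqrt_sq hβ] at key

theorem memHardy2_of_bounded {F : ℂ → ℂ} {M : ℝ} (dF : DifferentiableOn ℂ F disc)
    (hM : ∀ z ∈ disc, ‖F z‖ ≤ M) : MemHardy2 F := by
  refine ⟨dF, M ^ 2, ?_⟩
  rintro x ⟨r, hr0, hr1, rfl⟩
  have hb : ‖∫ t in (0:ℝ)..(2 * Real.pi), ‖F ((r : ℂ) * bpt t)‖ ^ 2‖ ≤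
      M ^ 2 * |2 * Real.pi - 0| := by
    refine intervalIntegral.norm_integral_le_of_norm_le_const fun t _ => ?_
    rw [Real.norm_of_nonneg (by positivity)]
    refine pow_le_pow_left₀ (norm_nonneg _) (hM _ ?_) 2
    rw [mem_disc, norm_mul, bpt, mul_comm I, Complex.norm_exp_ofReal_mul_I, mul_one,
      Complex.norm_real, Real.norm_of_nonneg hr0.le]
    exact hr1
  rw [sub_zero, abs_of_pos Real.two_pi_pos] at hb
  rw [one_div, inv_mul_le_iff₀ Real.two_pi_pos, mul_comm (2 * Real.pi) (M ^ 2)]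
  exact (Real.le_norm_self _).trans hb

theorem memA_iff {F : ℂ → ℂ} : MemA μ F ↔ DifferentiableOn ℂ F disc ∧
    (∃ M, ∀ z ∈ disc, ‖F z‖ ≤ M) ∧ IntegrableOn (dirichletDensity μ F) disc := by
  constructor
  · rintro ⟨⟨_, h2⟩, h3, h4⟩
    exact ⟨h3, h4, h2⟩
  · rintro ⟨h1, ⟨M, h2⟩, h3⟩
    exact ⟨⟨memHardy2_of_bounded h1 h2, h3⟩, h1, M, h2⟩

theorem supNorm_le {F : ℂ → ℂ} {M : ℝ} (hM : ∀ z ∈ disc, ‖F z‖ ≤ M) : supNorm F ≤ M := by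
  refine csSup_le ⟨‖F 0‖, 0, by simp [disc], rfl⟩ ?_
  rintro _ ⟨z, hz, rfl⟩
  exact hM z hz

theorem norm_le_supNorm {F : ℂ → ℂ} (hF : MemA μ F) {z : ℂ} (hz : z ∈ disc) :
    ‖F z‖ ≤ supNorm F := by
  obtain ⟨M, hM⟩ := hF.2.2
  refine le_csSup ⟨M, ?_⟩ ⟨z, hz, rfl⟩
  rintro _ ⟨w, hw, rfl⟩
  exact hM w hw

theorem supNorm_nonneg (F : ℂ → ℂ) : 0 ≤ supNorm F :=
  Real.sSup_nonneg (by rintro _ ⟨z, _, rfl⟩; exact norm_nonneg _)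

theorem memA_id [IsFiniteMeasure μ] (hμ : OnCircle μ) : MemA μ (fun z => z) := by
  refine memA_iff.2 ⟨differentiableOn_id, ⟨1, fun z hz => (mem_disc.1 hz).le⟩, ?_⟩
  have : dirichletDensity μ (fun z => z) = poissonMu μ := by
    ext z; simp [dirichletDensity]
  rw [this]
  exact integrableOn_poissonMu μ hμ

/-- The constant by which pointwise bounds relative to `f` control the algebra norm. -/
def normConst (μ : Measure ℂ) (f : ℂ → ℂ) : ℝ :=
  1 + √(dirichletIntegral μ (fun z => z)) + √(dirichletIntegral μ f)

theorem normConst_pos (μ : Measure ℂ) (f : ℂ → ℂ) : 0 < normConst μ f := by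
  unfold normConst; positivity

theorem memA_of_bounds [IsFiniteMeasure μ] (hμ : OnCircle μ) {F f : ℂ → ℂ} {M : ℝ} (hf : MemA μ f)
    (dF : DifferentiableOn ℂ F disc) (hM : ∀ z ∈ disc, ‖F z‖ ≤ M)
    (hM' : ∀ z ∈ disc, ‖deriv F z‖ ≤ M * (1 + ‖deriv f z‖)) :
    MemA μ F ∧ algNorm μ F ≤ M * normConst μ f := by
  have hM0 : 0 ≤ M := (norm_nonneg _).trans (hM 0 (by simp [disc]))
  obtain ⟨h1, h2⟩ := dirichlet_dominated hμ (F := F) hM0 hM0 (memA_id hμ).1.2 hf.1.2 (by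
    intro z hz
    have := hM' z hz
    simp only [deriv_id'', norm_one]
    linarith)
  refine ⟨memA_iff.2 ⟨dF, ⟨M, hM⟩, h1⟩, ?_⟩
  unfold algNorm normConst
  linarith [supNorm_le hM]

theorem memA_const [IsFiniteMeasure μ] (hμ : OnCircle μ) (c : ℂ) : MemA μ (fun _ => c) :=
  (memA_of_bounds hμ (memA_id hμ) (differentiableOn_const c) (M := ‖c‖) (fun _ _ => le_rfl)
    (fun z _ => by simp)).1

theorem memA_add [IsFiniteMeasure μ] (hμ : OnCircle μ) {f g : ℂ → ℂ} (hf : MemA μ f)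
    (hg : MemA μ g) :
    MemA μ (fun z => f z + g z) ∧
      algNorm μ (fun z => f z + g z) ≤ algNorm μ f + algNorm μ g := by
  have hb : ∀ z ∈ disc, ‖f z + g z‖ ≤ supNorm f + supNorm g := fun z hz =>
    (norm_add_le _ _).trans (add_le_add (norm_le_supNorm hf hz) (norm_le_supNorm hg hz))
  obtain ⟨h1, h2⟩ := dirichlet_dominated hμ (F := fun z => f z + g z) zero_le_one zero_le_one
    hf.1.2 hg.1.2 (by
      intro z hz
      have := (differentiableAt_of_disc hf.2.1 hz).hasDerivAt.add
        (differentiableAt_of_disc hg.2.1 hz).hasDerivAt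
      rw [show deriv (fun z => f z + g z) z = _ from this.deriv, one_mul, one_mul]
      exact norm_add_le _ _)
  refine ⟨memA_iff.2 ⟨hf.2.1.add hg.2.1, ⟨_, hb⟩, h1⟩, ?_⟩
  unfold algNorm
  linarith [supNorm_le hb]

theorem memA_mul [IsFiniteMeasure μ] (hμ : OnCircle μ) {f g : ℂ → ℂ} (hf : MemA μ f)
    (hg : MemA μ g) :
    MemA μ (fun z => f z * g z) ∧
      algNorm μ (fun z => f z * g z) ≤ algNorm μ f * algNorm μ g := by
  have hb : ∀ z ∈ disc, ‖f z * g z‖ ≤ supNorm f * supNorm g := fun z hz => by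
    rw [norm_mul]
    exact mul_le_mul (norm_le_supNorm hf hz) (norm_le_supNorm hg hz) (norm_nonneg _)
      (supNorm_nonneg f)
  obtain ⟨h1, h2⟩ := dirichlet_dominated hμ (F := fun z => f z * g z) (supNorm_nonneg g)
    (supNorm_nonneg f) hf.1.2 hg.1.2 (by
      intro z hz
      have := (differentiableAt_of_disc hf.2.1 hz).hasDerivAt.mul
        (differentiableAt_of_disc hg.2.1 hz).hasDerivAt
      rw [show deriv (fun z => f z * g z) z = _ from this.deriv]
      refine (norm_add_le _ _).trans ?_
      rw [norm_mul, norm_mul, mul_comm ‖deriv f z‖]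
      gcongr
      · exact norm_le_supNorm hg hz
      · exact norm_le_supNorm hf hz)
  refine ⟨memA_iff.2 ⟨hf.2.1.mul hg.2.1, ⟨_, hb⟩, h1⟩, ?_⟩
  unfold algNorm
  have h3 := supNorm_le hb
  nlinarith [mul_nonneg (Real.sqrt_nonneg (dirichletIntegral μ f))
    (Real.sqrt_nonneg (dirichletIntegral μ g))]

theorem algNorm_congr {f g : ℂ → ℂ} (h : ∀ z ∈ disc, f z = g z) : algNorm μ f = algNorm μ g := by
  have h1 : supNorm f = supNorm g := by
    unfold supNorm
    congr 1
    exact image_congr fun z hz => by rw [h z hz]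
  have h2 : dirichletIntegral μ f = dirichletIntegral μ g := by
    unfold dirichletIntegral
    congr 1
    refine setIntegral_congr_fun measurableSet_ball fun z hz => ?_
    have : f =ᶠ[𝓝 z] g := by
      filter_upwards [isOpen_disc.mem_nhds hz] with w hw using h w hw
    simp only [dirichletDensity, this.deriv_eq]
  unfold algNorm
  rw [h1, h2]

theorem algNorm_const (c : ℂ) : algNorm μ (fun _ => c) = ‖c‖ := by
  have h1 : supNorm (fun _ => c) = ‖c‖ := by
    unfold supNorm
    rw [Set.Nonempty.image_const ⟨0, by simp [disc]⟩, csSup_singleton]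
  have h2 : dirichletIntegral μ (fun _ => c) = 0 := by
    simp [dirichletIntegral, dirichletDensity]
  simp [algNorm, h1, h2]

theorem algNorm_neg (f : ℂ → ℂ) : algNorm μ (fun z => -f z) = algNorm μ f := by
  have h : deriv (fun z => -f z) = fun z => -deriv f z := by
    ext z; exact deriv.fun_neg
  simp [algNorm, supNorm, dirichletIntegral, dirichletDensity, h]

end Core

section Quotient

variable {μ : Measure ℂ} [IsFiniteMeasure μ]

/-- The algebra `D(μ) ∩ H^∞` as a subalgebra of all functions. -/
def boundedDirichletSubalgebra (hμ : OnCircle μ) : Subalgebra ℂ (ℂ → ℂ) where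
  carrier := {f | MemA μ f}
  mul_mem' hf hg := (memA_mul hμ hf hg).1
  add_mem' hf hg := (memA_add hμ hf hg).1
  algebraMap_mem' c := memA_const hμ c

/-- The algebra `D(μ) ∩ H^∞`, as a type without the topology of pointwise convergence. -/
def BoundedDirichlet (hμ : OnCircle μ) : Type := boundedDirichletSubalgebra hμ

instance (hμ : OnCircle μ) : CommRing (BoundedDirichlet hμ) :=
  inferInstanceAs (CommRing (boundedDirichletSubalgebra hμ))

instance (hμ : OnCircle μ) : Algebra ℂ (BoundedDirichlet hμ) :=
  inferInstanceAs (Algebra ℂ (boundedDirichletSubalgebra hμ))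

/-- The algebra norm as a ring seminorm (functions are not identified off the disc). -/
def algSeminorm (hμ : OnCircle μ) : RingSeminorm (BoundedDirichlet hμ) where
  toFun f := algNorm μ f.1
  map_zero' := (algNorm_const (μ := μ) 0).trans norm_zero
  add_le' f g := (memA_add hμ f.2 g.2).2
  neg' f := algNorm_neg f.1
  mul_le' f g := (memA_mul hμ f.2 g.2).2

instance (hμ : OnCircle μ) : SeminormedCommRing (BoundedDirichlet hμ) where
  __ := (algSeminorm hμ).toSeminormedRing
  mul_comm := mul_comm

instance (hμ : OnCircle μ) : NormedAlgebra ℂ (BoundedDirichlet hμ) where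
  norm_smul_le c f := by
    have := (memA_mul hμ (memA_const hμ c) f.2).2
    rwa [algNorm_const] at this

/-- A closed ideal as an `Ideal`. -/
def ClosedIdeal.toIdeal (hμ : OnCircle μ) {J : Set (ℂ → ℂ)} (hJ : ClosedIdeal μ J) :
    Ideal (BoundedDirichlet hμ) where
  carrier := {f | f.1 ∈ J}
  add_mem' hf hg := hJ.add_mem _ hf _ hg
  zero_mem' := hJ.zero_mem
  smul_mem' f _ hg := hJ.mul_mem _ f.2 _ hg

theorem ClosedIdeal.exists_representation (hμ : OnCircle μ) {J : Set (ℂ → ℂ)}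
    (hJ : ClosedIdeal μ J) :
    ∃ (B : Type) (_ : NormedCommRing B) (_ : NormedAlgebra ℂ B) (_ : CompleteSpace B)
      (π : BoundedDirichlet hμ →ₐ[ℂ] B), (∀ f, ‖π f‖ ≤ algNorm μ f.1) ∧
        ∀ f, π f = 0 ↔ f.1 ∈ J := by
  let I := hJ.toIdeal hμ
  let π : BoundedDirichlet hμ →ₐ[ℂ] UniformSpace.Completion (BoundedDirichlet hμ ⧸ I) :=
    { UniformSpace.Completion.coeRingHom.comp (Ideal.Quotient.mk I) with
      commutes' := fun c => (UniformSpace.Completion.algebraMap_def _ ℂ c).symm }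
  have hπ : ∀ f, ‖π f‖ = ‖Ideal.Quotient.mk I f‖ := fun f =>
    UniformSpace.Completion.norm_coe (Ideal.Quotient.mk I f)
  refine ⟨_, inferInstance, inferInstance, inferInstance, π, fun f => ?_, fun f => ?_⟩
  · exact (hπ f).trans_le (Ideal.Quotient.norm_mk_le I f)
  · constructor
    · intro h0
      have h1 : ‖Ideal.Quotient.mk I f‖ = 0 := by rw [← hπ, h0, norm_zero]
      refine hJ.closed _ f.2 fun ε hε => ?_
      have h2 : f ∈ closure (I : Set (BoundedDirichlet hμ)) :=
        QuotientAddGroup.norm_mk_eq_zero_iff_mem_closure.1 h1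
      obtain ⟨g, hg, hfg⟩ := Metric.mem_closure_iff.1 h2 ε hε
      rw [dist_eq_norm] at hfg
      exact ⟨g.1, hg, hfg⟩
    · intro hf
      have h1 : Ideal.Quotient.mk I f = 0 := Ideal.Quotient.eq_zero_iff_mem.2 hf
      rw [← norm_eq_zero, hπ, h1, norm_zero]

end Quotient

section Growth

variable {E : Type*} [NormedAddCommGroup E] [NormedSpace ℂ E]

/-- The real part of the singular weight used on rhombi. -/
theorem re_one_div_add (x y : ℝ) : (1 / (1 + I * (x + y * I)) + 1 / (1 - I * (x + y * I)) : ℂ).re =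
    (1 - y) / ((1 - y) ^ 2 + x ^ 2) + (1 + y) / ((1 + y) ^ 2 + x ^ 2) := by
  simp only [one_div, add_re, inv_re, normSq_apply]
  simp
  congr 2 <;> ring

theorem half_div_le {x y : ℝ} (h : |x| + |y| = 1) (hy : |y| < 1) :
    1 / (2 * |x|) ≤ (1 - y) / ((1 - y) ^ 2 + x ^ 2) + (1 + y) / ((1 + y) ^ 2 + x ^ 2) := by
  have hx : 0 < |x| := by linarith
  obtain ⟨h1, h2⟩ := abs_lt.1 hy
  rw [← sq_abs x]
  rcases abs_cases y with ⟨h3, _⟩ | ⟨h3, _⟩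
  · have e : 1 - y = |x| := by linarith
    have : 0 ≤ (1 + y) / ((1 + y) ^ 2 + |x| ^ 2) := div_nonneg (by linarith) (by positivity)
    rw [e]
    have : 1 / (2 * |x|) = |x| / (|x| ^ 2 + |x| ^ 2) := by field_simp; norm_num
    linarith
  · have e : 1 + y = |x| := by linarith
    have : 0 ≤ (1 - y) / ((1 - y) ^ 2 + |x| ^ 2) := div_nonneg (by linarith) (by positivity)
    rw [e]
    have : 1 / (2 * |x|) = |x| / (|x| ^ 2 + |x| ^ 2) := by field_simp; norm_num
    linarith

theorem norm_le_of_rhombus {g : ℂ → E} (hg : Differentiable ℂ g) {K L : ℝ} (hK : 0 < K)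
    (hL : 0 < L)
    (h : ∀ v : ℂ, |v.re| + |v.im| = 1 → v.re ≠ 0 → ‖g v‖ ≤ K * Real.exp (L / |v.re|))
    {x : ℝ} (hx : |x| < 1 / 4) : ‖g x‖ ≤ K * Real.exp (4 * L) := by
  obtain ⟨N, hN⟩ := (isCompact_closedBall (0 : ℂ) 2).exists_bound_of_continuousOn
    hg.continuous.continuousOn
  have hN0 : 0 ≤ N := (norm_nonneg _).trans (hN 0 (by simp))
  obtain ⟨η, hη0, hη1, hη⟩ : ∃ η : ℝ, 0 < η ∧ η ≤ 1 / 2 ∧ N * Real.exp (-(L / η)) ≤ K := by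
    refine ⟨min (1 / 2) (L * K / (N + 1)), by positivity, min_le_left _ _, ?_⟩
    set η := min (1 / 2) (L * K / (N + 1)) with hd
    have h0 : 0 < η := by positivity
    have h1 : η ≤ L * K / (N + 1) := min_le_right _ _
    have h2 : L / η ≤ Real.exp (L / η) := by linarith [Real.add_one_le_exp (L / η)]
    rw [Real.exp_neg, ← div_eq_mul_inv, div_le_iff₀ (Real.exp_pos _)]
    rw [le_div_iff₀ (by positivity)] at h1
    have h3 : N ≤ K * (L / η) := by
      rw [mul_div_assoc', le_div_iff₀ h0]; nlinarith
    nlinarith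
  let w : ℂ → ℂ := fun v => 1 / (1 + I * v) + 1 / (1 - I * v)
  let U : Set ℂ := {v | |v.re| + |v.im| < 1 ∧ |v.im| < 1 - η}
  have hwre : ∀ v : ℂ, (w v).re = (1 - v.im) / ((1 - v.im) ^ 2 + v.re ^ 2) +
      (1 + v.im) / ((1 + v.im) ^ 2 + v.re ^ 2) := fun v => by
    rw [← re_one_div_add, re_add_im]
  have c1 : Continuous fun v : ℂ => |v.re| + |v.im| := by fun_prop
  have c2 : Continuous fun v : ℂ => |v.im| := by fun_prop
  have hUo : IsOpen U := (isOpen_lt c1 continuous_const).inter (isOpen_lt c2 continuous_const)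
  have hcl : closure U ⊆ {v | |v.re| + |v.im| ≤ 1 ∧ |v.im| ≤ 1 - η} := by
    refine closure_minimal (fun v hv => ⟨hv.1.le, hv.2.le⟩) ?_
    exact (isClosed_le c1 continuous_const).inter (isClosed_le c2 continuous_const)
  have hball : closure U ⊆ closedBall 0 2 := fun v hv => by
    have := (hcl hv).1
    rw [mem_closedBall_zero_iff]
    linarith [Complex.norm_le_abs_re_add_abs_im v]
  have hd : DiffContOnCl ℂ (fun v => exp (-(2 * L : ℝ) * w v) • g v) U := by
    refine DifferentiableOn.diffContOnCl fun v hv => DifferentiableAt.differentiableWithinAt ?_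
    have h1 := abs_le.1 (hcl hv).2
    have e1 : 1 + I * v ≠ 0 := fun h0 => by
      have := congrArg re h0
      simp at this
      linarith
    have e2 : 1 - I * v ≠ 0 := fun h0 => by
      have := congrArg re h0
      simp at this
      linarith
    have hw : DifferentiableAt ℂ w v := by fun_prop (disch := assumption)
    exact ((hw.const_mul _).cexp).smul (hg v)
  have hnorm : ∀ v : ℂ, ‖exp (-(2 * L : ℝ) * w v) • g v‖ =
      Real.exp (-(2 * L * (w v).re)) * ‖g v‖ := fun v => by
    rw [norm_smul, norm_exp, ← ofReal_neg, re_ofReal_mul, neg_mul]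
  have hfr : ∀ v ∈ frontier U, ‖exp (-(2 * L : ℝ) * w v) • g v‖ ≤ K := by
    intro v hv
    rw [hnorm]
    have hvc : v ∈ closure U := frontier_subset_closure hv
    obtain ⟨h1, h2⟩ := hcl hvc
    have hvU : v ∉ U := by rw [frontier, hUo.interior_eq] at hv; exact hv.2
    by_cases hlt : |v.re| + |v.im| < 1
    · have h3 : |v.im| = 1 - η := le_antisymm h2 (not_lt.1 fun h => hvU ⟨hlt, h⟩)
      have h4 : 1 / (2 * η) ≤ (w v).re := by
        rw [hwre]
        have h5 : v.re ^ 2 ≤ η ^ 2 := by rw [← sq_abs v.re]; gcongr; linarith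
        have h6 : 1 / (2 * η) = η / (η ^ 2 + η ^ 2) := by field_simp; norm_num
        have h7 : η / (η ^ 2 + η ^ 2) ≤ η / (η ^ 2 + v.re ^ 2) := by gcongr
        rcases abs_cases v.im with ⟨h8, _⟩ | ⟨h8, _⟩
        · have e : 1 - v.im = η := by linarith
          have : 0 ≤ (1 + v.im) / ((1 + v.im) ^ 2 + v.re ^ 2) :=
            div_nonneg (by linarith) (by positivity)
          rw [e]; linarith
        · have e : 1 + v.im = η := by linarith
          have : 0 ≤ (1 - v.im) / ((1 - v.im) ^ 2 + v.re ^ 2) :=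
            div_nonneg (by linarith) (by positivity)
          rw [e]; linarith
      have h5 : L / η ≤ 2 * L * (w v).re := by
        have := mul_le_mul_of_nonneg_left h4 (by positivity : 0 ≤ 2 * L)
        have e : 2 * L * (1 / (2 * η)) = L / η := by field_simp
        linarith
      calc Real.exp (-(2 * L * (w v).re)) * ‖g v‖ ≤ Real.exp (-(L / η)) * N := by
            gcongr
            exact hN v (hball hvc)
        _ ≤ K := by linarith
    · have h3 : |v.re| + |v.im| = 1 := le_antisymm h1 (not_lt.1 hlt)
      have h4 : |v.im| < 1 := by linarith
      have h5 : 0 < |v.re| := by linarith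
      have h6 := half_div_le h3 h4
      rw [← hwre] at h6
      have h7 : L / |v.re| ≤ 2 * L * (w v).re := by
        have := mul_le_mul_of_nonneg_left h6 (by positivity : 0 ≤ 2 * L)
        have e : 2 * L * (1 / (2 * |v.re|)) = L / |v.re| := by field_simp
        linarith
      calc Real.exp (-(2 * L * (w v).re)) * ‖g v‖
          ≤ Real.exp (-(L / |v.re|)) * (K * Real.exp (L / |v.re|)) := by
            gcongr
            exact h v h3 (abs_pos.1 h5)
        _ = K := by rw [Real.exp_neg]; field_simp
  have hxU : (x : ℂ) ∈ U := by
    constructor <;> simp only [ofReal_re, ofReal_im, abs_zero] <;> linarith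
  have hmain := norm_le_of_forall_mem_frontier_norm_le (isBounded_closedBall.subset
    (subset_closure.trans hball)) hd hfr (subset_closure hxU)
  rw [hnorm, Real.exp_neg, inv_mul_le_iff₀ (Real.exp_pos _), mul_comm] at hmain
  refine hmain.trans ?_
  have hwx : (w x).re ≤ 2 := by
    rw [hwre]
    have : 1 / (1 + x ^ 2) ≤ 1 := by
      rw [div_le_one (by positivity)]; nlinarith [sq_nonneg x]
    simp only [ofReal_im, ofReal_re, sub_zero, add_zero, one_pow]
    linarith
  gcongr K * Real.exp ?_
  nlinarith

theorem exists_exponential_bound {F : ℂ → E} (hF : Differentiable ℂ F) {K : ℝ} (hK : 0 < K)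
    (h : ∀ u : ℂ, u.re ≠ 1 / 2 → ‖F u‖ ≤ K * Real.exp (K * (1 + ‖u‖ ^ 2) / |u.re - 1 / 2|)) :
    ∀ u, ‖F u‖ ≤ K * Real.exp (20 * K * (1 + ‖u‖)) := by
  intro u
  set R := 1 + ‖u‖ with hR
  have hR1 : 1 ≤ R := by linarith [norm_nonneg u]
  have hR0 : 0 < R := by linarith
  by_cases ht : R / 4 ≤ |u.re - 1 / 2|
  · have h0 : 0 < |u.re - 1 / 2| := by linarith
    refine (h u (fun h1 => by simp [h1] at h0)).trans ?_
    gcongr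
    rw [div_le_iff₀ h0]
    have : ‖u‖ = R - 1 := by linarith
    rw [this]
    nlinarith [mul_le_mul_of_nonneg_left ht (by positivity : 0 ≤ 20 * K * R)]
  · push Not at ht
    let c : ℂ := 1 / 2 + u.im * I
    have hg : Differentiable ℂ (fun v => F (c + R * v)) := by fun_prop
    have hcn : ‖c‖ ≤ R := by
      refine (norm_add_le _ _).trans ?_
      have : ‖(u.im * I : ℂ)‖ ≤ ‖u‖ := by simpa using abs_im_le_norm u
      have : ‖(1 / 2 : ℂ)‖ = 1 / 2 := by norm_num
      linarith
    have key := norm_le_of_rhombus hg hK (L := 5 * K * R) (by positivity) (by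
      intro v hv hv0
      have h1 : (c + R * v).re - 1 / 2 = R * v.re := by simp [c]
      have h2 : 0 < |v.re| := abs_pos.2 hv0
      refine (h _ fun h3 => ?_).trans ?_
      · rw [h3, sub_self] at h1
        exact (mul_ne_zero hR0.ne' hv0) h1.symm
      · rw [h1, abs_mul, abs_of_pos hR0]
        gcongr K * Real.exp ?_
        have h3 : ‖c + R * v‖ ≤ 2 * R := by
          refine (norm_add_le _ _).trans ?_
          rw [norm_mul, norm_real, Real.norm_of_nonneg hR0.le]
          have : ‖v‖ ≤ 1 := hv ▸ Complex.norm_le_abs_re_add_abs_im v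
          nlinarith
        rw [div_le_div_iff₀ (by positivity) h2]
        have h4 : 1 + ‖c + R * v‖ ^ 2 ≤ 5 * R * R := by
          nlinarith [norm_nonneg (c + R * v)]
        have h5 := mul_le_mul_of_nonneg_left h4 (by positivity : 0 ≤ K * |v.re|)
        nlinarith) (x := (u.re - 1 / 2) / R) (by
          rw [abs_div, abs_of_pos hR0, div_lt_iff₀ hR0]; linarith)
    have e : c + R * ((u.re - 1 / 2) / R : ℝ) = u := by
      have : (R : ℂ) ≠ 0 := by exact_mod_cast hR0.ne'
      push_cast
      rw [mul_div_cancel₀ _ this]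
      apply Complex.ext <;> simp [c]
    simp only [e] at key
    refine key.trans_eq ?_
    ring_nf

end Growth

section PolynomialGrowth

variable {E : Type*} [NormedAddCommGroup E] [NormedSpace ℂ E]

theorem norm_le_cubic_of_growth {F : ℂ → E} (hF : Differentiable ℂ F) {K L : ℝ} (hK : 0 < K)
    (hL : 0 < L) (hexp : ∀ u, ‖F u‖ ≤ K * Real.exp (L * (1 + ‖u‖)))
    (hleft : ∀ u : ℂ, u.re ≤ -1 → ‖F u‖ ≤ K * (1 + ‖u‖) ^ 3)
    (hreal : ∀ ε > 0, ∃ C, ∀ x : ℝ, 1 ≤ x → ‖F x‖ ≤ C * Real.exp (ε * x)) (u : ℂ) :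
    ‖F u‖ ≤ 8 * K * (2 + ‖u‖) ^ 3 := by
  by_cases hu : u.re ≤ -1
  · refine (hleft u hu).trans ?_
    have h1 : (1 + ‖u‖) ^ 3 ≤ (2 + ‖u‖) ^ 3 := by gcongr; norm_num
    have h2 : 0 ≤ (2 + ‖u‖) ^ 3 := by positivity
    nlinarith
  push Not at hu
  have hne : ∀ z : ℂ, 0 ≤ z.re → 1 ≤ ‖z + 1‖ := fun z hz => by
    refine le_trans ?_ (re_le_norm (z + 1))
    simpa using hz
  have key : ∀ ε : ℝ, 0 < ε → ∀ z : ℂ, 0 ≤ z.re →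
      ‖exp (-(ε * z)) • ((z + 1) ^ 3)⁻¹ • F (z - 1)‖ ≤ 8 * K := by
    intro ε hε z hz
    have hle : ∀ z : ℂ, 0 ≤ z.re → ‖exp (-(ε * z)) • ((z + 1) ^ 3)⁻¹ • F (z - 1)‖ ≤
        Real.exp (-(ε * z.re)) * ‖F (z - 1)‖ := fun z hz => by
      rw [norm_smul, norm_smul, norm_inv, norm_pow, norm_exp, neg_re, re_ofReal_mul]
      gcongr
      refine mul_le_of_le_one_left (norm_nonneg _) (inv_le_one_of_one_le₀ ?_)
      exact one_le_pow₀ (hne z hz)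
    refine PhragmenLindelof.right_half_plane_of_bounded_on_real
      (f := fun z : ℂ => exp (-(ε * z)) • ((z + 1) ^ 3)⁻¹ • F (z - 1)) ?_ ?_ ?_ ?_ hz
    · refine DifferentiableOn.diffContOnCl fun v hv => DifferentiableAt.differentiableWithinAt ?_
      have hv' : 0 ≤ v.re := closure_minimal (s := {z : ℂ | 0 < z.re}) (t := {z : ℂ | 0 ≤ z.re})
        (fun w (hw : 0 < w.re) => hw.le) (isClosed_le continuous_const continuous_re) hv
      have h1 : v + 1 ≠ 0 := norm_pos_iff.1 (one_pos.trans_le (hne v hv'))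
      have h2 : (v + 1) ^ 3 ≠ 0 := pow_ne_zero _ h1
      fun_prop (disch := assumption)
    · refine ⟨1, by norm_num, L, Asymptotics.IsBigO.of_bound (K * Real.exp (2 * L)) ?_⟩
      filter_upwards [mem_inf_of_right (mem_principal_self _)] with v hv
      have hv' : 0 ≤ v.re := le_of_lt hv
      refine (hle v hv').trans ?_
      rw [Real.rpow_one, Real.norm_of_nonneg (Real.exp_pos _).le, mul_assoc, ← Real.exp_add]
      have h1 : Real.exp (-(ε * v.re)) ≤ 1 := Real.exp_le_one_iff.2 (by nlinarith)
      have h2 : ‖v - 1‖ ≤ ‖v‖ + 1 := by simpa using norm_sub_le v 1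
      refine (mul_le_of_le_one_left (norm_nonneg _) h1).trans ((hexp _).trans ?_)
      gcongr
      nlinarith
    · obtain ⟨C, hC⟩ := hreal ε hε
      refine isBoundedUnder_of_eventually_le (a := |C|) ?_
      filter_upwards [eventually_ge_atTop 2] with x hx
      refine (hle x (by simp; linarith)).trans ?_
      have h1 := hC (x - 1) (by linarith)
      push_cast at h1
      rw [ofReal_re, Real.exp_neg, inv_mul_le_iff₀ (Real.exp_pos _), mul_comm]
      refine h1.trans ?_
      gcongr
      · exact le_abs_self C
      · linarith
    · intro x
      rw [norm_smul, norm_smul, norm_inv, norm_pow, norm_exp, neg_re, re_ofReal_mul]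
      have h0 := hne (x * I) (by simp)
      have h1 : ‖(x * I - 1 : ℂ)‖ = ‖(x * I + 1 : ℂ)‖ := by
        rw [Complex.norm_eq_sqrt_sq_add_sq, Complex.norm_eq_sqrt_sq_add_sq]
        simp
      have h2 := hleft (x * I - 1) (by simp)
      rw [h1] at h2
      simp only [re_ofReal_mul, I_re, mul_zero, neg_zero, Real.exp_zero, one_mul]
      rw [inv_mul_le_iff₀ (by positivity)]
      refine h2.trans ?_
      have h3 : (1 + ‖(x * I + 1 : ℂ)‖) ^ 3 ≤ (2 * ‖(x * I + 1 : ℂ)‖) ^ 3 := by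
        gcongr; linarith
      nlinarith
  have hz : 0 ≤ (u + 1).re := by simp; linarith
  have hlim : Tendsto (fun ε : ℝ => ‖exp (-(ε * (u + 1))) • ((u + 1 + 1) ^ 3)⁻¹ • F (u + 1 - 1)‖)
      (𝓝[>] 0) (𝓝 ‖((u + 1 + 1) ^ 3)⁻¹ • F (u + 1 - 1)‖) := by
    refine Tendsto.mono_left ?_ nhdsWithin_le_nhds
    refine Continuous.tendsto' (by fun_prop) _ _ (by simp)
  have h1 : ‖((u + 1 + 1) ^ 3)⁻¹ • F (u + 1 - 1)‖ ≤ 8 * K := by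
    refine le_of_tendsto hlim ?_
    filter_upwards [self_mem_nhdsWithin] with ε hε using key ε hε _ hz
  have h0 := hne _ hz
  rw [norm_smul, norm_inv, inv_mul_le_iff₀ (by rw [norm_pow]; positivity), norm_pow,
    add_sub_cancel_right] at h1
  refine h1.trans ?_
  have h2 : ‖u + 1 + 1‖ ≤ 2 + ‖u‖ := by
    rw [add_assoc, add_comm 2]
    refine (norm_add_le _ _).trans ?_
    norm_num
  rw [mul_comm]
  gcongr

end PolynomialGrowth

/-- The resolvent-type function of an element all of whose resolvents exist. -/
def entireResolvent {B : Type*} [NormedCommRing B] [NormedAlgebra ℂ B] (m : B) (u : ℂ) : B :=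
  Ring.inverse (1 - u • m)

theorem pow_four_eq_zero_of_growth {B : Type*} [NormedCommRing B] [NormedAlgebra ℂ B]
    [CompleteSpace B] (m : B) (hm : ∀ u : ℂ, IsUnit (1 - u • m)) {K : ℝ} (hK : 0 < K)
    (h : ∀ u : ℂ, u.re ≠ 1 / 2 →
      ‖entireResolvent m u‖ ≤ K * Real.exp (K * (1 + ‖u‖ ^ 2) / |u.re - 1 / 2|))
    (hleft : ∀ u : ℂ, u.re ≤ -1 → ‖entireResolvent m u‖ ≤ K * (1 + ‖u‖) ^ 3)
    (hreal : ∀ ε > 0, ∃ C, ∀ x : ℝ, 1 ≤ x → ‖entireResolvent m x‖ ≤ C * Real.exp (ε * x)) :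
    m ^ 4 = 0 := by
  have hG : Differentiable ℂ (entireResolvent m) := fun u => by
    have h1 : DifferentiableAt ℂ (fun u : ℂ => 1 - u • m) u := by fun_prop
    exact (differentiableAt_inverse (𝕜 := ℂ) (hm u)).comp u h1
  have hbound := norm_le_cubic_of_growth hG hK (by positivity : 0 < 20 * K)
    (exists_exponential_bound hG hK h) hleft hreal
  have hmul : ∀ u : ℂ, entireResolvent m u * (1 - u • m) = 1 := fun u =>
    Ring.inverse_mul_cancel _ (hm u)
  have hexpand : ∀ u : ℂ, u ^ 4 • (m ^ 4 * entireResolvent m u) =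
      entireResolvent m u - (1 + u • m + u ^ 2 • m ^ 2 + u ^ 3 • m ^ 3) := fun u => by
    have h1 := hmul u
    simp only [Algebra.smul_def, map_pow] at h1 ⊢
    linear_combination (-(1 + algebraMap ℂ B u * m + algebraMap ℂ B u ^ 2 * m ^ 2
      + algebraMap ℂ B u ^ 3 * m ^ 3)) * h1
  obtain ⟨C, hC0, hC⟩ : ∃ C, 0 ≤ C ∧
      ∀ u : ℂ, 1 ≤ ‖u‖ → ‖m ^ 4 * entireResolvent m u‖ ≤ C / ‖u‖ := by
    refine ⟨8 * K * 27 + (‖(1 : B)‖ + ‖m‖ + ‖m ^ 2‖ + ‖m ^ 3‖), by positivity, fun u hu => ?_⟩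
    have h0 : 0 < ‖u‖ := by linarith
    have h1 := congrArg norm (hexpand u)
    rw [norm_smul, norm_pow] at h1
    have hp1 : ‖u‖ ≤ ‖u‖ ^ 3 := le_self_pow₀ hu (by norm_num)
    have hp2 : ‖u‖ ^ 2 ≤ ‖u‖ ^ 3 := pow_le_pow_right₀ hu (by norm_num)
    have hp0 : 1 ≤ ‖u‖ ^ 3 := one_le_pow₀ hu
    have h2 : ‖entireResolvent m u‖ ≤ 8 * K * 27 * ‖u‖ ^ 3 := by
      refine (hbound u).trans ?_
      have : (2 + ‖u‖) ^ 3 ≤ (3 * ‖u‖) ^ 3 := by gcongr; linarith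
      nlinarith
    have h3 : ‖1 + u • m + u ^ 2 • m ^ 2 + u ^ 3 • m ^ 3‖ ≤
        (‖(1 : B)‖ + ‖m‖ + ‖m ^ 2‖ + ‖m ^ 3‖) * ‖u‖ ^ 3 := by
      refine norm_add₄_le.trans ?_
      simp only [norm_smul, norm_pow]
      have e1 := mul_le_mul_of_nonneg_right hp0 (norm_nonneg (1 : B))
      have e2 := mul_le_mul_of_nonneg_right hp1 (norm_nonneg m)
      have e3 := mul_le_mul_of_nonneg_right hp2 (norm_nonneg (m ^ 2))
      linarith
    have h4 := norm_sub_le (entireResolvent m u) (1 + u • m + u ^ 2 • m ^ 2 + u ^ 3 • m ^ 3)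
    rw [le_div_iff₀ h0]
    refine le_of_mul_le_mul_right ?_ (pow_pos h0 3)
    calc ‖m ^ 4 * entireResolvent m u‖ * ‖u‖ * ‖u‖ ^ 3
        = ‖u‖ ^ 4 * ‖m ^ 4 * entireResolvent m u‖ := by ring
      _ ≤ _ := by rw [h1]; linarith
  have hlim : Tendsto (fun u : ℂ => m ^ 4 * entireResolvent m u) (cocompact ℂ) (𝓝 0) := by
    refine squeeze_zero_norm' (a := fun u : ℂ => C / ‖u‖) ?_ ?_
    · filter_upwards [(tendsto_norm_cocompact_atTop (E := ℂ)).eventually_ge_atTop 1] with u hu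
        using hC u hu
    · exact Tendsto.div_atTop tendsto_const_nhds tendsto_norm_cocompact_atTop
  have := (hG.const_mul (m ^ 4)).apply_eq_of_tendsto_cocompact 0 hlim
  simpa [entireResolvent] using this

section Outer

theorem norm_bpt (t : ℝ) : ‖bpt t‖ = 1 := by
  rw [bpt, mul_comm I, Complex.norm_exp_ofReal_mul_I]

theorem continuous_bpt : Continuous bpt := by unfold bpt; fun_prop

theorem norm_herglotz_le (t : ℝ) {z : ℂ} (hz : z ∈ disc) :
    ‖(bpt t + z) / (bpt t - z)‖ ≤ 2 / (1 - ‖z‖) := by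
  have hz' := mem_disc.1 hz
  rw [norm_div]
  have h1 : ‖bpt t + z‖ ≤ 2 := (norm_add_le _ _).trans (by rw [norm_bpt]; linarith)
  have h2 : 1 - ‖z‖ ≤ ‖bpt t - z‖ := by
    have := norm_sub_norm_le (bpt t) z
    rwa [norm_bpt] at this
  gcongr

theorem bpt_sub_ne_zero (t : ℝ) {z : ℂ} (hz : z ∈ disc) : bpt t - z ≠ 0 := fun h => by
  have := mem_disc.1 hz
  rw [← sub_eq_zero.1 h, norm_bpt] at this
  exact lt_irrefl _ this

theorem countable_bpt_eq (ζ : ℂ) : {t : ℝ | bpt t = ζ}.Countable := by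
  by_cases h : ∃ s, bpt s = ζ
  · obtain ⟨s, rfl⟩ := h
    refine (countable_range fun n : ℤ => s + n * (2 * Real.pi)).mono fun t ht => ?_
    obtain ⟨n, hn⟩ := Complex.exp_eq_exp_iff_exists_int.1 ht
    refine ⟨n, ?_⟩
    have h1 : I * (t : ℂ) = I * ((s + n * (2 * Real.pi) : ℝ) : ℂ) := by
      rw [hn]; push_cast; ring
    exact (ofReal_injective (mul_left_cancel₀ I_ne_zero h1)).symm
  · rw [show {t : ℝ | bpt t = ζ} = ∅ from eq_empty_of_forall_notMem fun t ht => h ⟨t, ht⟩]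
    exact countable_empty

variable {f : ℂ → ℂ} {φ : ℝ → ℝ}

theorem OuterWith.ne_zero (h : OuterWith f φ) {z : ℂ} (hz : z ∈ disc) : f z ≠ 0 := by
  rw [h.2.2 z hz]; exact exp_ne_zero _

theorem OuterWith.norm_inv_le (h : OuterWith f φ) {z : ℂ} (hz : z ∈ disc) :
    ‖(f z)⁻¹‖ ≤ Real.exp ((2 * Real.pi)⁻¹ * ∫ t in (0:ℝ)..(2 * Real.pi),
      ‖(bpt t + z) / (bpt t - z) * (Real.log (φ t) : ℂ)‖) := by
  rw [h.2.2 z hz, ← exp_neg, norm_exp, Real.exp_le_exp]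
  refine (re_le_norm _).trans ?_
  rw [norm_neg, norm_mul, norm_inv, norm_real, Real.norm_of_nonneg Real.two_pi_pos.le]
  gcongr
  exact intervalIntegral.norm_integral_le_integral_norm Real.two_pi_pos.le

theorem continuous_herglotz {z : ℂ} (hz : z ∈ disc) :
    Continuous fun t => (bpt t + z) / (bpt t - z) :=
  (continuous_bpt.add continuous_const).div (continuous_bpt.sub continuous_const)
    fun t => bpt_sub_ne_zero t hz

theorem OuterWith.ofReal_log (h : OuterWith f φ) :
    IntervalIntegrable (fun t => (Real.log (φ t) : ℂ)) volume 0 (2 * Real.pi) :=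
  ⟨h.2.1.1.ofReal, h.2.1.2.ofReal⟩

theorem OuterWith.exists_norm_inv_le (h : OuterWith f φ) :
    ∃ K > 0, ∀ z ∈ disc, ‖(f z)⁻¹‖ ≤ Real.exp (K / (1 - ‖z‖)) := by
  have hψ := h.2.1
  set A := ∫ t in (0:ℝ)..(2 * Real.pi), |Real.log (φ t)| with hA
  have hA0 : 0 ≤ A := intervalIntegral.integral_nonneg Real.two_pi_pos.le fun t _ => abs_nonneg _
  refine ⟨(2 * Real.pi)⁻¹ * (2 * A) + 1, by positivity, fun z hz => ?_⟩
  refine (h.norm_inv_le hz).trans (Real.exp_le_exp.2 ?_)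
  have hz' : 0 < 1 - ‖z‖ := by linarith [mem_disc.1 hz]
  have h1 : ∫ t in (0:ℝ)..(2 * Real.pi), ‖(bpt t + z) / (bpt t - z) * (Real.log (φ t) : ℂ)‖ ≤
      ∫ t in (0:ℝ)..(2 * Real.pi), 2 / (1 - ‖z‖) * |Real.log (φ t)| := by
    refine intervalIntegral.integral_mono_on Real.two_pi_pos.le ?_ (hψ.abs.const_mul _) ?_
    · exact (h.ofReal_log.continuousOn_mul (continuous_herglotz hz).continuousOn).norm
    · intro t _
      rw [norm_mul, norm_real, Real.norm_eq_abs]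
      gcongr
      exact norm_herglotz_le t hz
  rw [intervalIntegral.integral_const_mul] at h1
  have h2 := mul_le_mul_of_nonneg_left h1 (inv_nonneg.2 Real.two_pi_pos.le)
  refine h2.trans ?_
  rw [le_div_iff₀ hz']
  have : (2 * Real.pi)⁻¹ * (2 / (1 - ‖z‖) * A) * (1 - ‖z‖) = (2 * Real.pi)⁻¹ * (2 * A) := by
    field_simp
  linarith

theorem OuterWith.norm_inv_radial_le (h : OuterWith f φ) {ζ : ℂ} (hζ : ‖ζ‖ = 1) {ε : ℝ}
    (hε : 0 < ε) :
    ∀ᶠ r : ℝ in 𝓝[<] 1, ‖(f (r * ζ))⁻¹‖ ≤ Real.exp (ε / (1 - r)) := by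
  have hψ := h.2.1
  have hnear : ∀ᶠ r : ℝ in 𝓝[<] 1, 0 < r ∧ r < 1 := by
    filter_upwards [self_mem_nhdsWithin, mem_nhdsWithin_of_mem_nhds (lt_mem_nhds one_pos)]
      with r h1 h2 using ⟨h2, h1⟩
  have hnorm : ∀ r : ℝ, 0 < r → ‖(r * ζ : ℂ)‖ = r := fun r hr => by
    rw [norm_mul, hζ, mul_one, norm_real, Real.norm_of_nonneg hr.le]
  have hlim : Tendsto (fun r : ℝ => ∫ t in (0:ℝ)..(2 * Real.pi),
      (1 - r) * ‖(bpt t + r * ζ) / (bpt t - r * ζ) * (Real.log (φ t) : ℂ)‖) (𝓝[<] 1)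
      (𝓝 (∫ t in (0:ℝ)..(2 * Real.pi), (0 : ℝ))) := by
    refine intervalIntegral.tendsto_integral_filter_of_dominated_convergence
      (fun t => 2 * |Real.log (φ t)|) ?_ ?_ (hψ.abs.const_mul _) ?_
    · filter_upwards [hnear] with r hr
      have hd : (r * ζ : ℂ) ∈ disc := mem_disc.2 (by rw [hnorm r hr.1]; exact hr.2)
      exact ((h.ofReal_log.continuousOn_mul
        (continuous_herglotz hd).continuousOn).norm.const_mul _).def'.aestronglyMeasurable
    · filter_upwards [hnear] with r hr
      refine Eventually.of_forall fun t _ => ?_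
      have hd : (r * ζ : ℂ) ∈ disc := mem_disc.2 (by rw [hnorm r hr.1]; exact hr.2)
      have h1 := norm_herglotz_le t hd
      rw [hnorm r hr.1] at h1
      have h0 : 0 < 1 - r := by linarith [hr.2]
      rw [Real.norm_of_nonneg (by positivity), norm_mul, norm_real, Real.norm_eq_abs, ← mul_assoc]
      gcongr
      rw [le_div_iff₀ h0] at h1
      linarith
    · have hnull : volume {t : ℝ | bpt t = ζ} = 0 := (countable_bpt_eq ζ).measure_zero _
      filter_upwards [compl_mem_ae_iff.2 hnull] with t ht _
      refine Tendsto.mono_left ?_ nhdsWithin_le_nhds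
      have h1 : bpt t - ((1 : ℝ) : ℂ) * ζ ≠ 0 := by
        simpa [sub_eq_zero] using ht
      have hc : ContinuousAt (fun r : ℝ =>
          (1 - r) * ‖(bpt t + r * ζ) / (bpt t - r * ζ) * (Real.log (φ t) : ℂ)‖) 1 := by
        fun_prop (disch := assumption)
      simpa [ContinuousAt] using hc
  rw [intervalIntegral.integral_zero] at hlim
  filter_upwards [hnear, hlim.eventually_lt_const (by positivity : 0 < 2 * Real.pi * ε)]
    with r hr hlt
  have hd : (r * ζ : ℂ) ∈ disc := mem_disc.2 (by rw [hnorm r hr.1]; exact hr.2)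
  have h0 : 0 < 1 - r := by linarith [hr.2]
  refine (h.norm_inv_le hd).trans (Real.exp_le_exp.2 ?_)
  rw [intervalIntegral.integral_const_mul] at hlt
  rw [le_div_iff₀ h0, mul_assoc, inv_mul_le_iff₀ Real.two_pi_pos]
  linarith

end Outer

section Quotients

variable {μ : Measure ℂ}

theorem norm_deriv_le_of_closedBall_subset {q : ℂ → ℂ} {s : Set ℂ} (hs : DifferentiableOn ℂ q s)
    {S R : ℝ} (hS : ∀ z ∈ s, ‖q z‖ ≤ S) (hR : 0 < R) {z : ℂ} (hz : closedBall z R ⊆ s) :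
    ‖deriv q z‖ ≤ S / R := by
  refine Complex.norm_deriv_le_of_forall_mem_sphere_norm_le hR ?_ fun w hw =>
    hS w (hz (sphere_subset_closedBall hw))
  exact ((hs.mono hz).mono closure_ball_subset_closedBall).diffContOnCl

theorem norm_dslope_le_of_bounded {f : ℂ → ℂ} (hf : DifferentiableOn ℂ f disc) {M : ℝ}
    (hM : ∀ z ∈ disc, ‖f z‖ ≤ M) {lam z : ℂ} (hl : lam ∈ disc) (hz : z ∈ disc) :
    ‖dslope f lam z‖ ≤ (2 * M + 1) / (1 - ‖lam‖) := by
  have hd : 0 < 1 - ‖lam‖ := by linarith [mem_disc.1 hl]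
  have hM0 : 0 ≤ M := (norm_nonneg _).trans (hM z hz)
  have hsub : ∀ w ∈ disc, ‖f w - f lam‖ < 2 * M + 1 := fun w hw => by
    linarith [norm_sub_le (f w) (f lam), hM w hw, hM lam hl]
  by_cases h : z ∈ ball lam (1 - ‖lam‖)
  · have hb : ball lam (1 - ‖lam‖) ⊆ disc := fun w hw => by
      rw [mem_ball, dist_eq_norm] at hw
      rw [mem_disc]
      have := norm_add_le (w - lam) lam
      rw [sub_add_cancel] at this
      linarith
    refine Complex.norm_dslope_le_div_of_mapsTo_ball (hf.mono hb) (fun w hw => ?_) h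
    rw [mem_closedBall, dist_eq_norm]
    exact (hsub w (hb hw)).le
  · have h1 : 1 - ‖lam‖ ≤ ‖z - lam‖ := by
      rw [mem_ball, dist_eq_norm] at h; exact not_lt.1 h
    have hne : z ≠ lam := fun h0 => by rw [h0, sub_self, norm_zero] at h1; linarith
    rw [dslope_of_ne _ hne, slope_def_field, norm_div]
    gcongr
    exact (hsub z hz).le

theorem exists_memA_dslope [IsFiniteMeasure μ] (hμ : OnCircle μ) {f : ℂ → ℂ} (hf : MemA μ f) :
    ∃ C > 0, ∀ lam ∈ disc, MemA μ (dslope f lam) ∧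
      algNorm μ (dslope f lam) ≤ C / (1 - ‖lam‖) ^ 2 := by
  obtain ⟨hdf, M, hM⟩ := hf.2
  have hM0 : 0 ≤ M := (norm_nonneg _).trans (hM 0 (by simp [disc]))
  refine ⟨4 * (2 * M + 2) * normConst μ f, by have := normConst_pos μ f; positivity,
    fun lam hl => ?_⟩
  set d := 1 - ‖lam‖ with hd_def
  have hd : 0 < d := by rw [hd_def]; linarith [mem_disc.1 hl]
  have hd1 : d ≤ 1 := by rw [hd_def]; linarith [norm_nonneg lam]
  set S := (2 * M + 1) / d with hS
  have hS0 : 0 ≤ S := by positivity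
  clear_value S
  have hq : ∀ z ∈ disc, ‖dslope f lam z‖ ≤ S := fun z hz => by
    rw [hS]; exact norm_dslope_le_of_bounded hdf hM hl hz
  have hdq : DifferentiableOn ℂ (dslope f lam) disc :=
    (Complex.differentiableOn_dslope (isOpen_disc.mem_nhds hl)).2 hdf
  have hq' : ∀ z ∈ disc, ‖deriv (dslope f lam) z‖ ≤ 4 / d * (S + ‖deriv f z‖) := by
    intro z hz
    by_cases h : ‖z - lam‖ < d / 2
    · have hb : closedBall z (d / 4) ⊆ disc := fun w hw => by
        rw [mem_closedBall, dist_eq_norm] at hw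
        rw [mem_disc]
        have h1 := norm_add₃_le (a := w - z) (b := z - lam) (c := lam)
        rw [sub_add_sub_cancel, sub_add_cancel] at h1
        linarith
      refine (norm_deriv_le_of_closedBall_subset hdq hq (by positivity) hb).trans ?_
      rw [div_div_eq_mul_div, div_mul_eq_mul_div]
      refine div_le_div_of_nonneg_right ?_ hd.le
      linarith [norm_nonneg (deriv f z)]
    · have h1 : HasDerivAt (fun w => (w - lam) * dslope f lam w)
          (1 * dslope f lam z + (z - lam) * deriv (dslope f lam) z) z :=
        ((hasDerivAt_id z).sub_const lam).mul (differentiableAt_of_disc hdq hz).hasDerivAt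
      have h2 : (fun w => (w - lam) * dslope f lam w) = fun w => f w - f lam := by
        ext w; exact sub_smul_dslope f lam w
      rw [h2] at h1
      have h3 := h1.unique ((differentiableAt_of_disc hdf hz).hasDerivAt.sub_const _)
      have h4 : 0 < ‖z - lam‖ := by linarith
      have h5 : (z - lam) * deriv (dslope f lam) z = deriv f z - dslope f lam z := by
        rw [← h3]; ring
      have h6 := congrArg norm h5
      rw [norm_mul] at h6
      have h7 := norm_sub_le (deriv f z) (dslope f lam z)
      have h8 := hq z hz
      rw [div_mul_eq_mul_div, le_div_iff₀ hd]
      nlinarith [norm_nonneg (deriv (dslope f lam) z), norm_nonneg (deriv f z)]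
  have hS1 : S + 1 ≤ (2 * M + 2) / d := by
    rw [le_div_iff₀ hd, hS, add_mul, div_mul_cancel₀ _ hd.ne']
    linarith
  have hX : 4 / d * (S + 1) ≤ 4 * (2 * M + 2) / d ^ 2 := by
    calc 4 / d * (S + 1) ≤ 4 / d * ((2 * M + 2) / d) := by gcongr
      _ = _ := by field_simp
  obtain ⟨h1, h2⟩ := memA_of_bounds hμ hf hdq (M := 4 / d * (S + 1))
    (fun z hz => by
      refine (hq z hz).trans ?_
      have : 1 ≤ 4 / d := by rw [le_div_iff₀ hd]; linarith
      nlinarith)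
    (fun z hz => by
      refine (hq' z hz).trans ?_
      rw [mul_assoc]
      gcongr
      nlinarith [norm_nonneg (deriv f z)])
  refine ⟨h1, h2.trans ?_⟩
  rw [mul_div_right_comm]
  have := normConst_pos μ f
  gcongr

theorem memA_inv_linear [IsFiniteMeasure μ] (hμ : OnCircle μ) {a b : ℂ} (h : ‖b‖ < ‖a‖) :
    MemA μ (fun z => (a + b * z)⁻¹) ∧ algNorm μ (fun z => (a + b * z)⁻¹) ≤
      ((‖a‖ - ‖b‖)⁻¹ + ‖b‖ * (‖a‖ - ‖b‖)⁻¹ ^ 2) * normConst μ (fun z => z) := by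
  have hd : 0 < ‖a‖ - ‖b‖ := sub_pos.2 h
  have hlow : ∀ z ∈ disc, ‖a‖ - ‖b‖ ≤ ‖a + b * z‖ := fun z hz => by
    have h1 := norm_sub_norm_le a (-(b * z))
    rw [sub_neg_eq_add, norm_neg, norm_mul] at h1
    nlinarith [norm_nonneg b, mem_disc.1 hz]
  have hne : ∀ z ∈ disc, a + b * z ≠ 0 := fun z hz =>
    norm_pos_iff.1 (hd.trans_le (hlow z hz))
  have hder : ∀ z ∈ disc, HasDerivAt (fun z => (a + b * z)⁻¹) (-b / (a + b * z) ^ 2) z :=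
    fun z hz => by
      have h1 : HasDerivAt (fun z => a + b * z) b z := by
        simpa using ((hasDerivAt_id z).const_mul b).const_add a
      exact h1.inv (hne z hz)
  have hinv : ∀ z ∈ disc, ‖(a + b * z)⁻¹‖ ≤ (‖a‖ - ‖b‖)⁻¹ := fun z hz => by
    rw [norm_inv]; exact inv_anti₀ hd (hlow z hz)
  refine memA_of_bounds hμ (memA_id hμ)
    (fun z hz => (hder z hz).differentiableAt.differentiableWithinAt) ?_ ?_
  · intro z hz
    have := hinv z hz
    have : 0 ≤ ‖b‖ * (‖a‖ - ‖b‖)⁻¹ ^ 2 := by positivity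
    linarith
  · intro z hz
    rw [(hder z hz).deriv, neg_div, norm_neg, div_eq_mul_inv, norm_mul, ← inv_pow, norm_pow]
    have h1 : ‖b‖ * ‖(a + b * z)⁻¹‖ ^ 2 ≤ ‖b‖ * (‖a‖ - ‖b‖)⁻¹ ^ 2 := by
      gcongr; exact hinv z hz
    have h2 : 0 ≤ ‖b‖ * (‖a‖ - ‖b‖)⁻¹ ^ 2 := by positivity
    have h3 : 0 < (‖a‖ - ‖b‖)⁻¹ := by positivity
    simp only [deriv_id'', norm_one]
    linarith

end Quotients

section ParametricIntegral

theorem dslope_comm (f : ℂ → ℂ) (a b : ℂ) : dslope f a b = dslope f b a := by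
  rcases eq_or_ne a b with rfl | h
  · rfl
  · rw [dslope_of_ne _ h.symm, dslope_of_ne _ h, slope_comm]

theorem differentiableOn_integral_of_bounded {α : Type*} [MeasurableSpace α] {ν : Measure α}
    [IsFiniteMeasure ν]
    {G : ℂ → α → ℂ} {U : Set ℂ} (hU : IsOpen U) {N : ℝ}
    (hmeas : ∀ z ∈ U, AEStronglyMeasurable (G z) ν)
    (hdiff : ∀ᵐ t ∂ν, DifferentiableOn ℂ (fun z => G z t) U)
    (hbd : ∀ᵐ t ∂ν, ∀ z ∈ U, ‖G z t‖ ≤ N) :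
    DifferentiableOn ℂ (fun z => ∫ t, G z t ∂ν) U := by
  intro z₀ hz₀
  obtain ⟨r, hr, hrU⟩ := Metric.isOpen_iff.1 hU z₀ hz₀
  have hderiv : ∀ᵐ t ∂ν, ∀ z ∈ ball z₀ (r / 2),
      HasDerivAt (fun z => G z t) (deriv (fun z => G z t) z) z := by
    filter_upwards [hdiff] with t ht z hz
    exact (ht.differentiableAt (hU.mem_nhds
      (hrU (ball_subset_ball (by linarith) hz)))).hasDerivAt
  have hmeas' : AEStronglyMeasurable (fun t => deriv (fun z => G z t) z₀) ν := by
    set u : ℕ → ℂ := fun n => ((r / (n + 2) : ℝ) : ℂ) with hu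
    have hupos : ∀ n : ℕ, 0 < r / ((n : ℝ) + 2) := fun n => by positivity
    have hu0 : Tendsto u atTop (𝓝[≠] 0) := by
      refine tendsto_nhdsWithin_iff.2 ⟨?_, Eventually.of_forall fun n => ?_⟩
      · have h1 : Tendsto (fun n : ℕ => r / ((n : ℝ) + 2)) atTop (𝓝 0) :=
          tendsto_const_nhds.div_atTop
            (tendsto_atTop_add_const_right _ _ tendsto_natCast_atTop_atTop)
        have h2 := (continuous_ofReal.tendsto 0).comp h1
        rwa [ofReal_zero] at h2
      · exact ofReal_ne_zero.2 (hupos n).ne'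
    have humem : ∀ n, z₀ + u n ∈ U := fun n => hrU <| by
      rw [mem_ball, dist_eq_norm, add_sub_cancel_left, norm_real, Real.norm_of_nonneg (hupos n).le]
      rw [div_lt_iff₀ (by positivity)]
      have : (0 : ℝ) ≤ n := n.cast_nonneg
      nlinarith
    refine aestronglyMeasurable_of_tendsto_ae atTop
      (f := fun n t => (u n)⁻¹ • (G (z₀ + u n) t - G z₀ t)) (fun n => ?_) ?_
    · exact ((hmeas _ (humem n)).sub (hmeas _ hz₀)).const_smul (u n)⁻¹
    · filter_upwards [hderiv] with t ht
      exact (ht z₀ (mem_ball_self (by positivity))).tendsto_slope_zero.comp hu0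
  have key := hasDerivAt_integral_of_dominated_loc_of_deriv_le (μ := ν) (F := G)
    (F' := fun z t => deriv (fun z => G z t) z) (bound := fun _ => N / (r / 4))
    (ball_mem_nhds z₀ (by positivity : 0 < r / 2)) ?_ ?_ hmeas' ?_ (integrable_const _) ?_
  · exact key.2.differentiableAt.differentiableWithinAt
  · filter_upwards [hU.mem_nhds hz₀] with z hz using hmeas z hz
  · refine Integrable.of_bound (hmeas z₀ hz₀) N ?_
    filter_upwards [hbd] with t ht using ht z₀ hz₀
  · filter_upwards [hdiff, hbd] with t h1 h2 z hz
    refine norm_deriv_le_of_closedBall_subset h1 h2 (by positivity) fun w hw => hrU ?_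
    rw [mem_closedBall] at hw
    rw [mem_ball] at hz ⊢
    linarith [dist_triangle w z z₀]
  · filter_upwards [hderiv] with t ht z hz using ht z hz

end ParametricIntegral

section Chord

/-- Parametrization of the chord of the unit circle joining `e^{-iα}` to `e^{iα}`. -/
def chord (α t : ℝ) : ℂ := Real.cos α + t * (Real.sin α * I)

/-- The polynomial `(z - e^{iα})(z - e^{-iα})`. -/
def chordPoly (α : ℝ) (z : ℂ) : ℂ := z ^ 2 - 2 * Real.cos α * z + 1

/-- A branch on the disc of the logarithm of `(z - e^{iα}) / (z - e^{-iα})`. -/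
def chordLog (α : ℝ) (z : ℂ) : ℂ :=
  log (1 - z * exp (-(α * I))) - log (1 - z * exp (α * I)) + 2 * α * I

variable {α : ℝ}

theorem exp_mul_I_eq : exp (α * I) = Real.cos α + Real.sin α * I := by
  rw [exp_mul_I, ofReal_cos, ofReal_sin]

theorem exp_neg_mul_I_eq : exp (-(α * I)) = Real.cos α - Real.sin α * I := by
  rw [← neg_mul, exp_mul_I, cos_neg, sin_neg, ofReal_cos, ofReal_sin]; ring

theorem cos_sq_add_sin_sq_ofReal (α : ℝ) : (Real.cos α : ℂ) ^ 2 + (Real.sin α : ℂ) ^ 2 = 1 := by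
  exact_mod_cast Real.cos_sq_add_sin_sq α

theorem chordPoly_eq (z : ℂ) :
    chordPoly α z = (1 - z * exp (-(α * I))) * (1 - z * exp (α * I)) := by
  rw [exp_mul_I_eq, exp_neg_mul_I_eq, chordPoly]
  linear_combination (-z ^ 2) * cos_sq_add_sin_sq_ofReal α +
    z ^ 2 * (Real.sin α : ℂ) ^ 2 * I_sq

theorem chordPoly_chord (t : ℝ) :
    chordPoly α (chord α t) = (Real.sin α ^ 2 * (1 - t ^ 2) : ℝ) := by
  rw [chordPoly, chord]
  push_cast
  linear_combination (t ^ 2 * Complex.sin α ^ 2) * I_sq - Complex.cos_sq_add_sin_sq α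

theorem chord_eq (t : ℝ) : chord α t = (Real.cos α : ℝ) + (t * Real.sin α : ℝ) * I := by
  rw [chord]; push_cast; ring

theorem norm_chord_sq (t : ℝ) : ‖chord α t‖ ^ 2 = 1 - Real.sin α ^ 2 * (1 - t ^ 2) := by
  rw [chord_eq, Complex.sq_norm, normSq_add_mul_I]
  linear_combination Real.cos_sq_add_sin_sq α

theorem chord_re (t : ℝ) : (chord α t).re = Real.cos α := by
  rw [chord_eq, add_re, ofReal_re, re_ofReal_mul, I_re, mul_zero, add_zero]

theorem chord_im (t : ℝ) : (chord α t).im = t * Real.sin α := by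
  rw [chord_eq, add_im, ofReal_im, im_ofReal_mul, I_im, mul_one, zero_add]

theorem re_one_sub_pos {z c : ℂ} (hz : z ∈ disc) (hc : ‖c‖ = 1) : 0 < (1 - z * c).re := by
  have h1 : (z * c).re ≤ ‖z‖ := by
    simpa [hc] using re_le_norm (z * c)
  rw [sub_re, one_re]
  linarith [mem_disc.1 hz]

theorem norm_exp_mul_I (α : ℝ) : ‖exp (α * I)‖ = 1 := norm_exp_ofReal_mul_I α

theorem norm_exp_neg_mul_I (α : ℝ) : ‖exp (-(α * I))‖ = 1 := by
  rw [← neg_mul, ← ofReal_neg, norm_exp_ofReal_mul_I]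

theorem differentiableOn_chordLog : DifferentiableOn ℂ (chordLog α) disc := fun z hz => by
  have h1 : 1 - z * exp (-(α * I)) ∈ slitPlane := Or.inl (re_one_sub_pos hz (norm_exp_neg_mul_I α))
  have h2 : 1 - z * exp (α * I) ∈ slitPlane := Or.inl (re_one_sub_pos hz (norm_exp_mul_I α))
  refine DifferentiableAt.differentiableWithinAt ?_
  unfold chordLog
  fun_prop (disch := assumption)

theorem norm_mul_norm_log_le {x : ℂ} (h0 : x ≠ 0) (h2 : ‖x‖ ≤ 2) : ‖x‖ * ‖log x‖ ≤ 10 := by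
  have hx : 0 < ‖x‖ := norm_pos_iff.2 h0
  have h1 : ‖log x‖ ≤ |Real.log ‖x‖| + Real.pi := by
    refine (Complex.norm_le_abs_re_add_abs_im _).trans ?_
    rw [log_re, log_im]
    gcongr
    exact abs_arg_le_pi x
  have h3 : ‖x‖ * |Real.log ‖x‖| ≤ 2 := by
    rcases le_total ‖x‖ 1 with h | h
    · rw [abs_of_nonpos (Real.log_nonpos hx.le h), ← Real.log_inv]
      have := Real.log_le_sub_one_of_pos (inv_pos.2 hx)
      calc ‖x‖ * Real.log ‖x‖⁻¹ ≤ ‖x‖ * (‖x‖⁻¹ - 1) := by gcongr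
        _ = 1 - ‖x‖ := by field_simp
        _ ≤ 2 := by linarith
    · rw [abs_of_nonneg (Real.log_nonneg h)]
      have := Real.log_le_sub_one_of_pos hx
      nlinarith [Real.log_nonneg h]
  nlinarith [Real.pi_lt_four]

theorem norm_chordPoly_mul_chordLog_le (hα0 : 0 < α) (hα1 : α < 1) {z : ℂ} (hz : z ∈ disc) :
    ‖chordPoly α z * chordLog α z‖ ≤ 60 := by
  set x := 1 - z * exp (-(α * I)) with hx
  set y := 1 - z * exp (α * I) with hy
  have hx0 : x ≠ 0 := fun h => by
    have := re_one_sub_pos hz (norm_exp_neg_mul_I α)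
    rw [← hx, h] at this
    exact lt_irrefl _ this
  have hy0 : y ≠ 0 := fun h => by
    have := re_one_sub_pos hz (norm_exp_mul_I α)
    rw [← hy, h] at this
    exact lt_irrefl _ this
  have hz' := mem_disc.1 hz
  have hx2 : ‖x‖ ≤ 2 := (norm_sub_le _ _).trans (by
    rw [norm_mul, norm_exp_neg_mul_I, norm_one]; linarith)
  have hy2 : ‖y‖ ≤ 2 := (norm_sub_le _ _).trans (by
    rw [norm_mul, norm_exp_mul_I, norm_one]; linarith)
  have h1 := norm_mul_norm_log_le hx0 hx2
  have h2 := norm_mul_norm_log_le hy0 hy2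
  rw [chordPoly_eq, chordLog, ← hx, ← hy, norm_mul, norm_mul]
  have h3 : ‖log x - log y + 2 * α * I‖ ≤ ‖log x‖ + ‖log y‖ + 2 := by
    refine (norm_add_le _ _).trans (add_le_add (norm_sub_le _ _) ?_)
    simp only [norm_mul, norm_I, norm_real, Real.norm_of_nonneg hα0.le, mul_one]
    norm_num
    linarith
  calc ‖x‖ * ‖y‖ * ‖log x - log y + 2 * α * I‖
      ≤ ‖x‖ * ‖y‖ * (‖log x‖ + ‖log y‖ + 2) := by gcongr
    _ = ‖y‖ * (‖x‖ * ‖log x‖) + ‖x‖ * (‖y‖ * ‖log y‖) + 2 * (‖x‖ * ‖y‖) := by ring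
    _ ≤ 2 * 10 + 2 * 10 + 2 * (2 * 2) := by gcongr
    _ ≤ 60 := by norm_num

theorem eq_of_exp_eq {X Y : ℂ} (h : exp X = exp Y) (hlt : |X.im - Y.im| < 2 * Real.pi) :
    X = Y := by
  obtain ⟨n, hn⟩ := Complex.exp_eq_exp_iff_exists_int.1 h
  have h1 : X.im - Y.im = n * (2 * Real.pi) := by rw [hn]; simp
  rw [h1, abs_mul, abs_of_pos Real.two_pi_pos] at hlt
  have h2 : |(n : ℝ)| < 1 := by
    by_contra hc
    push Not at hc
    nlinarith [Real.two_pi_pos]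
  have h3 : n = 0 := by
    rw [← Int.cast_abs] at h2
    exact Int.abs_lt_one_iff.1 (by exact_mod_cast h2)
  simpa [h3] using hn

theorem abs_log_im_lt {x : ℂ} (h : 0 < x.re) : |(log x).im| < Real.pi / 2 := by
  rw [log_im]; exact abs_arg_lt_pi_div_two_iff.2 (Or.inl h)

theorem ne_zero_of_re_pos {x : ℂ} (h : 0 < x.re) : x ≠ 0 := fun h0 => by simp [h0] at h

theorem setIntegral_Ioo_eq_sub {g g' : ℝ → ℂ} (h : ∀ t, HasDerivAt g (g' t) t)
    (hc : Continuous g') : ∫ t in Ioo (-1 : ℝ) 1, g' t = g 1 - g (-1) := by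
  rw [← integral_Ioc_eq_integral_Ioo, ← intervalIntegral.integral_of_le (by norm_num)]
  exact intervalIntegral.integral_eq_sub_of_hasDerivAt (fun t _ => h t)
    (hc.intervalIntegrable _ _)

theorem continuous_chord : Continuous (chord α) := by unfold chord; fun_prop

theorem hasDerivAt_chord (t : ℝ) : HasDerivAt (chord α) (Real.sin α * I) t := by
  have h := ((hasDerivAt_id t).ofReal_comp.mul_const (Real.sin α * I)).const_add
    (Real.cos α : ℂ)
  rwa [ofReal_one, one_mul] at h

theorem integral_chord_left (hα0 : 0 < α) (hα1 : α < 1) {z : ℂ} (hz : z ∈ disc)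
    (hre : z.re < Real.cos α) :
    ∫ t in Ioo (-1 : ℝ) 1, (Real.sin α * I) / (chord α t - z) = chordLog α z := by
  have hpos : ∀ t, 0 < (chord α t - z).re := fun t => by rw [sub_re, chord_re]; linarith
  rw [setIntegral_Ioo_eq_sub (g := fun t => log (chord α t - z))
    (fun t => ((hasDerivAt_chord t).sub_const z).clog_real (Or.inl (hpos t)))
    (continuous_const.div (continuous_chord.sub continuous_const)
      fun t => ne_zero_of_re_pos (hpos t))]
  have p1 := re_one_sub_pos hz (norm_exp_neg_mul_I α)
  have p2 := re_one_sub_pos hz (norm_exp_mul_I α)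
  have hE : exp (α * I) * exp (-(α * I)) = 1 := by rw [← exp_add, add_neg_cancel, exp_zero]
  have e1 : log (chord α 1 - z) = log (1 - z * exp (-(α * I))) + α * I := by
    refine eq_of_exp_eq ?_ ?_
    · rw [exp_add, exp_log (ne_zero_of_re_pos (hpos 1)), exp_log (ne_zero_of_re_pos p1), chord]
      have := exp_mul_I_eq (α := α)
      push_cast at this ⊢
      linear_combination -this + z * hE
    · have h1 := abs_lt.1 (abs_log_im_lt (hpos 1))
      have h2 := abs_lt.1 (abs_log_im_lt p1)
      have : (log (1 - z * exp (-(α * I))) + α * I).im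
        = (log (1 - z * exp (-(α * I)))).im + α := by simp
      rw [this, abs_lt]
      constructor <;> linarith [Real.pi_gt_three]
  have e2 : log (chord α (-1) - z) = log (1 - z * exp (α * I)) + -(α * I) := by
    refine eq_of_exp_eq ?_ ?_
    · rw [exp_add, exp_log (ne_zero_of_re_pos (hpos (-1))),
        exp_log (ne_zero_of_re_pos p2), chord]
      have := exp_neg_mul_I_eq (α := α)
      push_cast at this ⊢
      linear_combination -this + z * hE
    · have h1 := abs_lt.1 (abs_log_im_lt (hpos (-1)))
      have h2 := abs_lt.1 (abs_log_im_lt p2)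
      have : (log (1 - z * exp (α * I)) + -(α * I)).im
        = (log (1 - z * exp (α * I))).im - α := by simp [sub_eq_add_neg]
      rw [this, abs_lt]
      constructor <;> linarith [Real.pi_gt_three]
  rw [e1, e2, chordLog]
  ring

theorem integral_chord_right (hα0 : 0 < α) (hα1 : α < 1) {z : ℂ} (hz : z ∈ disc)
    (hre : Real.cos α < z.re) :
    ∫ t in Ioo (-1 : ℝ) 1, (Real.sin α * I) / (chord α t - z) =
      chordLog α z - 2 * Real.pi * I := by
  have hpos : ∀ t, 0 < (z - chord α t).re := fun t => by rw [sub_re, chord_re]; linarith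
  have hint : (fun t => (Real.sin α * I) / (chord α t - z)) =
      fun t => (-(Real.sin α * I)) / (z - chord α t) := by
    ext t; rw [← neg_sub z, div_neg, neg_div]
  rw [hint, setIntegral_Ioo_eq_sub (g := fun t => log (z - chord α t))
    (fun t => ((hasDerivAt_chord t).const_sub z).clog_real (Or.inl (hpos t)))
    (continuous_const.div (continuous_const.sub continuous_chord)
      fun t => ne_zero_of_re_pos (hpos t))]
  have p1 := re_one_sub_pos hz (norm_exp_neg_mul_I α)
  have p2 := re_one_sub_pos hz (norm_exp_mul_I α)
  have hE : exp (α * I) * exp (-(α * I)) = 1 := by rw [← exp_add, add_neg_cancel, exp_zero]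
  have e1 : log (z - chord α 1) = log (1 - z * exp (-(α * I))) + (α * I - Real.pi * I) := by
    refine eq_of_exp_eq ?_ ?_
    · rw [exp_add, exp_sub, exp_pi_mul_I, exp_log (ne_zero_of_re_pos (hpos 1)),
        exp_log (ne_zero_of_re_pos p1), chord]
      have := exp_mul_I_eq (α := α)
      push_cast at this ⊢
      linear_combination this - z * hE
    · have h1 := abs_lt.1 (abs_log_im_lt (hpos 1))
      have h2 := abs_lt.1 (abs_log_im_lt p1)
      have : (log (1 - z * exp (-(α * I))) + (α * I - Real.pi * I)).im
        = (log (1 - z * exp (-(α * I)))).im + (α - Real.pi) := by simp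
      rw [this, abs_lt]
      constructor <;> linarith [Real.pi_gt_three]
  have e2 : log (z - chord α (-1)) = log (1 - z * exp (α * I)) + (-(α * I) + Real.pi * I) := by
    refine eq_of_exp_eq ?_ ?_
    · rw [exp_add, exp_add, exp_pi_mul_I, exp_log (ne_zero_of_re_pos (hpos (-1))),
        exp_log (ne_zero_of_re_pos p2), chord]
      have := exp_neg_mul_I_eq (α := α)
      push_cast at this ⊢
      linear_combination this - z * hE
    · have h1 := abs_lt.1 (abs_log_im_lt (hpos (-1)))
      have h2 := abs_lt.1 (abs_log_im_lt p2)
      have : (log (1 - z * exp (α * I)) + (-(α * I) + Real.pi * I)).im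
        = (log (1 - z * exp (α * I))).im + (-α + Real.pi) := by simp
      rw [this, abs_lt]
      constructor <;> linarith [Real.pi_gt_three]
  rw [e1, e2, chordLog]
  ring

end Chord

/-- `f` is holomorphic on the disc, bounded below by `δ` within distance `ε` of `1`, and the
chord of half-angle `α` lies well inside this neighbourhood. -/
structure ChordSetting (f : ℂ → ℂ) (δ ε α : ℝ) : Prop where
  differentiableOn : DifferentiableOn ℂ f disc
  delta_pos : 0 < δ
  le_norm : ∀ z ∈ disc ∩ ball 1 ε, δ ≤ ‖f z‖
  alpha_pos : 0 < α
  alpha_lt_one : α < 1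
  alpha_le : 4 * α ≤ ε

/-- The quotient of `chordPoly α` by `f`. -/
def chordQuot (f : ℂ → ℂ) (α : ℝ) (z : ℂ) : ℂ := chordPoly α z / f z

/-- The Cauchy transform of `chordQuot f α` along the chord. -/
def chordCauchy (f : ℂ → ℂ) (α : ℝ) (z : ℂ) : ℂ :=
  ∫ t in Ioo (-1 : ℝ) 1, chordQuot f α (chord α t) * ((Real.sin α * I) / (chord α t - z))

/-- The holomorphic extension of `chordCauchy f α` across the chord. -/
def chordExt (f : ℂ → ℂ) (α : ℝ) (z : ℂ) : ℂ :=
  (∫ t in Ioo (-1 : ℝ) 1, dslope (chordQuot f α) (chord α t) z * (Real.sin α * I)) +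
    chordQuot f α z * chordLog α z

theorem norm_chordPoly_sub_le (α : ℝ) {y w : ℂ} (hy : y ∈ disc) (hw : w ∈ disc) :
    ‖chordPoly α y - chordPoly α w‖ ≤ 4 * ‖y - w‖ := by
  have h : chordPoly α y - chordPoly α w = (y + w - 2 * Real.cos α) * (y - w) := by
    rw [chordPoly, chordPoly]; ring
  rw [h, norm_mul]
  gcongr
  have h2 : ‖(2 * Real.cos α : ℂ)‖ ≤ 2 := by
    rw [norm_mul, norm_real, Real.norm_eq_abs]
    norm_num
    exact Real.abs_cos_le_one α
  calc ‖y + w - 2 * Real.cos α‖ ≤ ‖y‖ + ‖w‖ + ‖(2 * Real.cos α : ℂ)‖ :=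
        (norm_sub_le _ _).trans (by gcongr; exact norm_add_le _ _)
    _ ≤ 4 := by linarith [mem_disc.1 hy, mem_disc.1 hw]

theorem norm_chordPoly_le (α : ℝ) {z : ℂ} (hz : z ∈ disc) : ‖chordPoly α z‖ ≤ 4 := by
  have hz := (mem_disc.1 hz).le
  rw [chordPoly_eq, norm_mul]
  have h1 : ‖1 - z * exp (-(α * I))‖ ≤ 2 := (norm_sub_le _ _).trans (by
    rw [norm_mul, norm_exp_neg_mul_I, norm_one]; linarith)
  have h2 : ‖1 - z * exp (α * I)‖ ≤ 2 := (norm_sub_le _ _).trans (by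
    rw [norm_mul, norm_exp_mul_I, norm_one]; linarith)
  nlinarith [norm_nonneg (1 - z * exp (-(α * I))), norm_nonneg (1 - z * exp (α * I))]

theorem differentiable_chordPoly (α : ℝ) : Differentiable ℂ (chordPoly α) := by
  unfold chordPoly; fun_prop

theorem norm_deriv_chordPoly_le (α : ℝ) {z : ℂ} (hz : z ∈ disc) :
    ‖deriv (chordPoly α) z‖ ≤ 4 := by
  have h : HasDerivAt (chordPoly α) (2 * z - 2 * Real.cos α) z := by
    have := (((hasDerivAt_id z).pow 2).sub
      ((hasDerivAt_id z).const_mul (2 * Real.cos α : ℂ))).add_const 1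
    exact HasDerivAt.congr_deriv (f := chordPoly α) this (by simp)
  rw [h.deriv]
  refine (norm_sub_le _ _).trans ?_
  rw [norm_mul, norm_mul, norm_real, Real.norm_eq_abs]
  norm_num
  linarith [Real.abs_cos_le_one α, mem_disc.1 hz]

theorem norm_sub_one_sq (z : ℂ) : ‖z - 1‖ ^ 2 = ‖z‖ ^ 2 + 1 - 2 * z.re := by
  rw [Complex.sq_norm, Complex.sq_norm, normSq_apply, normSq_apply, sub_re, sub_im, one_re,
    one_im]
  ring

theorem norm_sin_mul_I_le (α : ℝ) : ‖(Real.sin α * I : ℂ)‖ ≤ 1 := by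
  rw [norm_mul, norm_real, norm_I, mul_one, Real.norm_eq_abs]
  exact Real.abs_sin_le_one α

theorem isOpen_disc_inter_ball (ε : ℝ) : IsOpen (disc ∩ ball (1 : ℂ) ε) :=
  isOpen_disc.inter isOpen_ball

namespace ChordSetting

variable {f : ℂ → ℂ} {δ ε α : ℝ}

theorem sin_pos (H : ChordSetting f δ ε α) : 0 < Real.sin α :=
  Real.sin_pos_of_pos_of_lt_pi H.alpha_pos (by linarith [H.alpha_lt_one, Real.pi_gt_three])

theorem eps_pos (H : ChordSetting f δ ε α) : 0 < ε := by linarith [H.alpha_pos, H.alpha_le]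

theorem cos_lt_one (H : ChordSetting f δ ε α) : Real.cos α < 1 := by
  nlinarith [Real.sin_sq_add_cos_sq α, H.sin_pos, Real.cos_le_one α]

theorem depth_pos (H : ChordSetting f δ ε α) {t : ℝ} (ht : t ∈ Ioo (-1 : ℝ) 1) :
    0 < Real.sin α ^ 2 * (1 - t ^ 2) :=
  mul_pos (pow_pos H.sin_pos 2) (by nlinarith [ht.1, ht.2])

theorem depth_le (H : ChordSetting f δ ε α) (t : ℝ) : Real.sin α ^ 2 * (1 - t ^ 2) ≤ α ^ 2 := by
  have := Real.sin_le H.alpha_pos.le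
  nlinarith [H.sin_pos, mul_nonneg (sq_nonneg (Real.sin α)) (sq_nonneg t)]

theorem norm_chordPoly_chord (H : ChordSetting f δ ε α) {t : ℝ} (ht : t ∈ Ioo (-1 : ℝ) 1) :
    ‖chordPoly α (chord α t)‖ = Real.sin α ^ 2 * (1 - t ^ 2) := by
  rw [chordPoly_chord, norm_real, Real.norm_of_nonneg (H.depth_pos ht).le]

theorem norm_chord_le (H : ChordSetting f δ ε α) {t : ℝ} (ht : t ∈ Ioo (-1 : ℝ) 1) :
    ‖chord α t‖ ≤ 1 - ‖chordPoly α (chord α t)‖ / 2 := by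
  rw [H.norm_chordPoly_chord ht]
  have h1 := H.depth_pos ht
  have h2 := H.depth_le t
  refine abs_le_of_sq_le_sq' ?_ (by nlinarith [H.alpha_pos, H.alpha_lt_one]) |>.2
  rw [norm_chord_sq]
  nlinarith

theorem chord_mem_disc (H : ChordSetting f δ ε α) {t : ℝ} (ht : t ∈ Ioo (-1 : ℝ) 1) :
    chord α t ∈ disc := by
  have h1 := H.norm_chord_le ht
  rw [H.norm_chordPoly_chord ht] at h1
  exact mem_disc.2 (by linarith [H.depth_pos ht])

theorem norm_chord_sub_one_le (H : ChordSetting f δ ε α) {t : ℝ} (ht : t ∈ Ioo (-1 : ℝ) 1) :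
    ‖chord α t - 1‖ ≤ α := by
  refine abs_le_of_sq_le_sq' ?_ H.alpha_pos.le |>.2
  rw [norm_sub_one_sq, norm_chord_sq, chord_re]
  linarith [H.depth_pos ht, Real.one_sub_sq_div_two_le_cos (x := α)]

theorem ball_chord_subset (H : ChordSetting f δ ε α) {t : ℝ} (ht : t ∈ Ioo (-1 : ℝ) 1) :
    ball (chord α t) (‖chordPoly α (chord α t)‖ / 4) ⊆ disc ∩ ball 1 ε := fun z hz => by
  rw [mem_ball, dist_eq_norm] at hz
  have h1 := H.norm_chord_le ht
  have h2 := H.norm_chord_sub_one_le ht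
  have h3 := H.depth_le t
  have h4 := H.depth_pos ht
  rw [H.norm_chordPoly_chord ht] at *
  refine ⟨mem_disc.2 ?_, mem_ball_iff_norm.2 ?_⟩
  · have := norm_le_norm_add_norm_sub' z (chord α t)
    linarith
  · have := norm_sub_le_norm_sub_add_norm_sub z (chord α t) 1
    nlinarith [H.alpha_le, H.alpha_pos, H.alpha_lt_one]

theorem chord_mem (H : ChordSetting f δ ε α) {t : ℝ} (ht : t ∈ Ioo (-1 : ℝ) 1) :
    chord α t ∈ disc ∩ ball 1 ε :=
  H.ball_chord_subset ht (mem_ball_self (by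
    rw [H.norm_chordPoly_chord ht]; linarith [H.depth_pos ht]))

theorem differentiableOn_chordQuot (H : ChordSetting f δ ε α) :
    DifferentiableOn ℂ (chordQuot f α) (disc ∩ ball 1 ε) :=
  (differentiable_chordPoly α).differentiableOn.div (H.differentiableOn.mono inter_subset_left)
    fun z hz h0 => by
      have := H.le_norm z hz
      rw [h0, norm_zero] at this
      linarith [H.delta_pos]

theorem norm_chordQuot_le (H : ChordSetting f δ ε α) {z : ℂ} (hz : z ∈ disc ∩ ball 1 ε) :
    ‖chordQuot f α z‖ ≤ ‖chordPoly α z‖ / δ := by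
  rw [chordQuot, norm_div]
  exact div_le_div_of_nonneg_left (norm_nonneg _) H.delta_pos (H.le_norm z hz)

theorem norm_dslope_chordQuot_le (H : ChordSetting f δ ε α) {t : ℝ} (ht : t ∈ Ioo (-1 : ℝ) 1)
    {z : ℂ}
    (hz : z ∈ disc ∩ ball 1 ε) :
    ‖dslope (chordQuot f α) (chord α t) z‖ ≤ 12 / δ := by
  set w := chord α t with hw
  set d := ‖chordPoly α w‖ with hd
  have hwm := H.chord_mem ht
  have hd0 : 0 < d := by rw [hd, H.norm_chordPoly_chord ht]; exact H.depth_pos ht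
  have key : ∀ y ∈ disc ∩ ball 1 ε,
      ‖chordQuot f α y - chordQuot f α w‖ ≤ (2 * d + 4 * ‖y - w‖) / δ := fun y hy => by
    have h1 := norm_chordPoly_sub_le α hy.1 hwm.1
    have h2 := norm_le_norm_add_norm_sub' (chordPoly α y) (chordPoly α w)
    calc _ ≤ ‖chordPoly α y‖ / δ + d / δ :=
          (norm_sub_le _ _).trans (add_le_add (H.norm_chordQuot_le hy) (H.norm_chordQuot_le hwm))
      _ = (‖chordPoly α y‖ + d) / δ := by ring
      _ ≤ _ := by gcongr ?_ / δ; exacts [H.delta_pos.le, by linarith]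
  by_cases hb : z ∈ ball w (d / 4)
  · have := Complex.norm_dslope_le_div_of_mapsTo_ball (f := chordQuot f α) (c := w)
      (R₁ := d / 4) (R₂ := 3 * d / δ)
      (H.differentiableOn_chordQuot.mono (H.ball_chord_subset ht)) (fun y hy => by
        rw [mem_closedBall_iff_norm]
        refine (key y (H.ball_chord_subset ht hy)).trans ?_
        gcongr ?_ / δ
        · exact H.delta_pos.le
        · linarith [mem_ball_iff_norm.1 hy]) hb
    refine this.trans (le_of_eq ?_)
    have := H.delta_pos.ne'
    field_simp
    norm_num
  · rw [mem_ball_iff_norm, not_lt] at hb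
    have hpos : 0 < ‖z - w‖ := by linarith
    have hne : z ≠ w := fun h => by simp [h] at hpos
    rw [dslope_of_ne _ hne, slope_def_field, norm_div, div_le_iff₀ hpos]
    refine (key z hz).trans ?_
    rw [div_mul_eq_mul_div]
    gcongr ?_ / δ
    · exact H.delta_pos.le
    · linarith

theorem continuousOn_dslope_chord (H : ChordSetting f δ ε α) {z : ℂ} (hz : z ∈ disc ∩ ball 1 ε) :
    ContinuousOn (fun t => dslope (chordQuot f α) (chord α t) z) (Ioo (-1 : ℝ) 1) := by
  have h := (Complex.differentiableOn_dslope ((isOpen_disc_inter_ball ε).mem_nhds hz)).2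
    H.differentiableOn_chordQuot
  exact (h.continuousOn.comp continuous_chord.continuousOn fun t ht => H.chord_mem ht).congr
    fun t _ => by simp only [Function.comp_apply]; rw [dslope_comm]

theorem aestronglyMeasurable_dslope_chord (H : ChordSetting f δ ε α) {z : ℂ}
    (hz : z ∈ disc ∩ ball 1 ε) :
    AEStronglyMeasurable (fun t => dslope (chordQuot f α) (chord α t) z * (Real.sin α * I))
      (volume.restrict (Ioo (-1 : ℝ) 1)) :=
  ((H.continuousOn_dslope_chord hz).mul continuousOn_const).aestronglyMeasurable
    measurableSet_Ioo

theorem norm_dslope_chord_mul_le (H : ChordSetting f δ ε α) {t : ℝ} (ht : t ∈ Ioo (-1 : ℝ) 1)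
    {z : ℂ}
    (hz : z ∈ disc ∩ ball 1 ε) :
    ‖dslope (chordQuot f α) (chord α t) z * (Real.sin α * I)‖ ≤ 12 / δ := by
  rw [norm_mul]
  exact (mul_le_mul (H.norm_dslope_chordQuot_le ht hz) (norm_sin_mul_I_le α) (norm_nonneg _)
    (div_nonneg (by norm_num) H.delta_pos.le)).trans (mul_one _).le

theorem differentiableOn_chordExt (H : ChordSetting f δ ε α) :
    DifferentiableOn ℂ (chordExt f α) (disc ∩ ball 1 ε) := by
  refine DifferentiableOn.add ?_ (H.differentiableOn_chordQuot.mul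
    (differentiableOn_chordLog.mono inter_subset_left))
  refine differentiableOn_integral_of_bounded (N := 12 / δ) (isOpen_disc_inter_ball ε)
    (fun z hz => H.aestronglyMeasurable_dslope_chord hz) ?_ ?_
  · refine (ae_restrict_iff' measurableSet_Ioo).2 (.of_forall fun t ht => ?_)
    exact
      ((Complex.differentiableOn_dslope ((isOpen_disc_inter_ball ε).mem_nhds (H.chord_mem ht))).2
      H.differentiableOn_chordQuot).mul_const _
  · exact (ae_restrict_iff' measurableSet_Ioo).2 (.of_forall fun t ht z hz =>
      H.norm_dslope_chord_mul_le ht hz)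

theorem norm_chordExt_le (H : ChordSetting f δ ε α) {z : ℂ} (hz : z ∈ disc ∩ ball 1 ε) :
    ‖chordExt f α z‖ ≤ 84 / δ := by
  have h1 : ‖∫ t in Ioo (-1 : ℝ) 1, dslope (chordQuot f α) (chord α t) z * (Real.sin α * I)‖ ≤
      12 / δ * 2 := by
    refine (norm_setIntegral_le_of_norm_le_const (by simp)
      (fun t ht => H.norm_dslope_chord_mul_le ht hz)).trans (le_of_eq ?_)
    rw [Real.volume_real_Ioo_of_le (by norm_num)]
    norm_num
  have h2 : ‖chordQuot f α z * chordLog α z‖ ≤ 60 / δ := by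
    have h3 := norm_chordPoly_mul_chordLog_le H.alpha_pos H.alpha_lt_one hz.1
    calc ‖chordQuot f α z * chordLog α z‖
        ≤ ‖chordPoly α z‖ / δ * ‖chordLog α z‖ := by
          rw [norm_mul]; gcongr; exact H.norm_chordQuot_le hz
      _ = ‖chordPoly α z * chordLog α z‖ / δ := by rw [norm_mul]; ring
      _ ≤ 60 / δ := by gcongr; exact H.delta_pos.le
  refine (norm_add_le _ _).trans ((add_le_add h1 h2).trans (le_of_eq ?_))
  ring

theorem integral_dslope_eq (H : ChordSetting f δ ε α) {z : ℂ} (hz : z ∈ disc ∩ ball 1 ε)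
    (hre : z.re ≠ Real.cos α) :
    ∫ t in Ioo (-1 : ℝ) 1, dslope (chordQuot f α) (chord α t) z * (Real.sin α * I) =
      chordCauchy f α z - chordQuot f α z *
        ∫ t in Ioo (-1 : ℝ) 1, (Real.sin α * I) / (chord α t - z) := by
  have hne : ∀ t, chord α t - z ≠ 0 := fun t h => by
    have := congrArg Complex.re h
    rw [sub_re, chord_re, zero_re] at this
    exact hre (by linarith)
  have hi1 : IntegrableOn (fun t => dslope (chordQuot f α) (chord α t) z * (Real.sin α * I))
      (Ioo (-1 : ℝ) 1) :=
    Integrable.of_bound (H.aestronglyMeasurable_dslope_chord hz) (12 / δ)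
      ((ae_restrict_iff' measurableSet_Ioo).2 (.of_forall fun t ht =>
        H.norm_dslope_chord_mul_le ht hz))
  have hi2 : IntegrableOn (fun t => (Real.sin α * I) / (chord α t - z)) (Ioo (-1 : ℝ) 1) :=
    ((continuous_const.div (continuous_chord.sub continuous_const) hne).integrableOn_Icc
      (a := -1) (b := 1)).mono_set Ioo_subset_Icc_self
  rw [eq_sub_iff_add_eq, ← integral_const_mul, ← integral_add hi1 (hi2.const_mul _), chordCauchy]
  refine setIntegral_congr_fun measurableSet_Ioo fun t _ => ?_
  have hne' : z ≠ chord α t := fun h => hne t (by rw [h, sub_self])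
  have h1 := hne t
  have h2 := sub_ne_zero.2 hne'
  rw [dslope_of_ne _ hne', slope_def_field, ← neg_sub (chord α t) z]
  field_simp
  ring

theorem chordExt_eq_of_lt (H : ChordSetting f δ ε α) {z : ℂ} (hz : z ∈ disc ∩ ball 1 ε)
    (hre : z.re < Real.cos α) :
    chordExt f α z = chordCauchy f α z := by
  rw [chordExt, H.integral_dslope_eq hz hre.ne,
    integral_chord_left H.alpha_pos H.alpha_lt_one hz.1 hre]
  ring

theorem chordExt_eq_of_gt (H : ChordSetting f δ ε α) {z : ℂ} (hz : z ∈ disc ∩ ball 1 ε)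
    (hre : Real.cos α < z.re) :
    chordExt f α z = chordCauchy f α z + 2 * Real.pi * I * chordQuot f α z := by
  rw [chordExt, H.integral_dslope_eq hz hre.ne',
    integral_chord_right H.alpha_pos H.alpha_lt_one hz.1 hre]
  ring

end ChordSetting

open Classical in
/-- The function equal to `chordExt f α` within distance `ε` of `1` and to `chordCauchy f α`
elsewhere. -/
def chordGlue (f : ℂ → ℂ) (ε α : ℝ) (z : ℂ) : ℂ :=
  if z ∈ disc ∩ ball (1 : ℂ) ε then chordExt f α z else chordCauchy f α z

namespace ChordSetting

variable {f : ℂ → ℂ} {δ ε α : ℝ}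

theorem chordCauchy_bounds (H : ChordSetting f δ ε α) {z : ℂ} {r : ℝ} (hr : 0 < r)
    (hz : ∀ t ∈ Ioo (-1 : ℝ) 1, r ≤ ‖chord α t - z‖) :
    DifferentiableAt ℂ (chordCauchy f α) z ∧ ‖chordCauchy f α z‖ ≤ 4 / (δ * r) ∧
      ‖deriv (chordCauchy f α) z‖ ≤ 16 / (δ * r ^ 2) := by
  have hδ := H.delta_pos
  have hfar : ∀ y ∈ ball z (r / 2), ∀ t ∈ Ioo (-1 : ℝ) 1, r / 2 ≤ ‖chord α t - y‖ :=
    fun y hy t ht => by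
      have h1 := hz t ht
      have h2 := norm_sub_le_norm_sub_add_norm_sub (chord α t) y z
      linarith [mem_ball_iff_norm.1 hy]
  have hbd : ∀ y ∈ ball z (r / 2), ∀ t ∈ Ioo (-1 : ℝ) 1,
      ‖chordQuot f α (chord α t) * ((Real.sin α * I) / (chord α t - y))‖ ≤ 2 / (δ * r) :=
    fun y hy t ht => by
      have h1 : ‖chordQuot f α (chord α t)‖ ≤ 1 / δ := by
        refine (H.norm_chordQuot_le (H.chord_mem ht)).trans ?_
        gcongr
        rw [H.norm_chordPoly_chord ht]
        nlinarith [H.depth_le t, H.alpha_pos, H.alpha_lt_one]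
      have h2 : ‖(Real.sin α * I) / (chord α t - y)‖ ≤ 1 / (r / 2) := by
        rw [norm_div]
        exact div_le_div₀ zero_le_one (norm_sin_mul_I_le α) (by linarith) (hfar y hy t ht)
      rw [norm_mul]
      calc _ ≤ 1 / δ * (1 / (r / 2)) := by gcongr
        _ = _ := by field_simp
  have hd : DifferentiableOn ℂ (chordCauchy f α) (ball z (r / 2)) := by
    refine differentiableOn_integral_of_bounded (N := 2 / (δ * r)) isOpen_ball ?_ ?_ ?_
    · intro y hy
      refine ContinuousOn.aestronglyMeasurable ?_ measurableSet_Ioo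
      refine (H.differentiableOn_chordQuot.continuousOn.comp continuous_chord.continuousOn
        fun t ht => H.chord_mem ht).mul (continuousOn_const.div
          (continuous_chord.sub continuous_const).continuousOn fun t ht h0 => ?_)
      have := hfar y hy t ht
      rw [h0, norm_zero] at this
      linarith
    · refine (ae_restrict_iff' measurableSet_Ioo).2 (.of_forall fun t ht => ?_)
      refine DifferentiableOn.const_mul (DifferentiableOn.div (differentiableOn_const _)
        ((differentiableOn_const _).sub differentiableOn_id) fun y hy h0 => ?_) _
      have := hfar y hy t ht
      rw [show chord α t = y from sub_eq_zero.1 h0, sub_self, norm_zero] at this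
      linarith
    · exact (ae_restrict_iff' measurableSet_Ioo).2 (.of_forall fun t ht y hy => hbd y hy t ht)
  have hC : ∀ y ∈ ball z (r / 2), ‖chordCauchy f α y‖ ≤ 4 / (δ * r) := fun y hy => by
    refine (norm_setIntegral_le_of_norm_le_const (by simp) (hbd y hy)).trans (le_of_eq ?_)
    rw [Real.volume_real_Ioo_of_le (by norm_num)]
    ring
  have hz0 : z ∈ ball z (r / 2) := mem_ball_self (by linarith)
  refine ⟨hd.differentiableAt (isOpen_ball.mem_nhds hz0), hC z hz0, ?_⟩
  refine (norm_deriv_le_of_closedBall_subset hd hC (R := r / 4) (by linarith)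
    (closedBall_subset_ball (by linarith))).trans (le_of_eq ?_)
  field_simp
  norm_num

theorem mem_nhd_of_cos_le (H : ChordSetting f δ ε α) {z : ℂ} (hz : z ∈ disc)
    (hre : Real.cos α ≤ z.re) : z ∈ disc ∩ ball 1 ε := by
  refine ⟨hz, mem_ball_iff_norm.2 (lt_of_pow_lt_pow_left₀ 2 H.eps_pos.le ?_)⟩
  rw [norm_sub_one_sq]
  have h1 := mem_disc.1 hz
  nlinarith [Real.one_sub_sq_div_two_le_cos (x := α), norm_nonneg z, H.alpha_le, H.alpha_pos]

theorem exists_chord_eq (H : ChordSetting f δ ε α) {z : ℂ} (hz : z ∈ disc)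
    (hre : z.re = Real.cos α) : ∃ t ∈ Ioo (-1 : ℝ) 1, chord α t = z := by
  have hs := H.sin_pos
  have h1 : z.im ^ 2 < Real.sin α ^ 2 := by
    have h2 := Complex.sq_norm z
    rw [normSq_apply, hre] at h2
    nlinarith [mem_disc.1 hz, norm_nonneg z, Real.sin_sq_add_cos_sq α]
  have h3 := abs_lt.1 (abs_lt_of_sq_lt_sq h1 hs.le)
  refine ⟨z.im / Real.sin α, ⟨?_, ?_⟩, Complex.ext ?_ ?_⟩
  · rw [lt_div_iff₀ hs]; linarith
  · rw [div_lt_iff₀ hs]; linarith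
  · rw [chord_re, hre]
  · rw [chord_im, div_mul_cancel₀ _ hs.ne']

theorem le_norm_chord_sub (z : ℂ) (t : ℝ) : |z.re - Real.cos α| ≤ ‖chord α t - z‖ := by
  have := abs_re_le_norm (chord α t - z)
  rwa [sub_re, chord_re, abs_sub_comm] at this

theorem differentiableAt_chordCauchy (H : ChordSetting f δ ε α) {z : ℂ}
    (hre : z.re ≠ Real.cos α) : DifferentiableAt ℂ (chordCauchy f α) z :=
  (H.chordCauchy_bounds (abs_pos.2 (sub_ne_zero.2 hre)) fun t _ => le_norm_chord_sub z t).1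

theorem chordGlue_of_lt (H : ChordSetting f δ ε α) {z : ℂ} (hre : z.re < Real.cos α) :
    chordGlue f ε α z = chordCauchy f α z := by
  unfold chordGlue
  split_ifs with h
  exacts [H.chordExt_eq_of_lt h hre, rfl]

theorem chordGlue_of_gt (H : ChordSetting f δ ε α) {z : ℂ} (hz : z ∈ disc)
    (hre : Real.cos α < z.re) :
    chordGlue f ε α z = chordCauchy f α z + 2 * Real.pi * I * chordQuot f α z := by
  have h := H.mem_nhd_of_cos_le hz hre.le
  rw [chordGlue, if_pos h, H.chordExt_eq_of_gt h hre]

theorem eventually_re_lt {z : ℂ} {c : ℝ} (h : z.re < c) : ∀ᶠ y in 𝓝 z, y.re < c :=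
  continuous_re.continuousAt.eventually_lt_const h

theorem eventually_lt_re {z : ℂ} {c : ℝ} (h : c < z.re) : ∀ᶠ y in 𝓝 z, c < y.re :=
  continuous_re.continuousAt.eventually_const_lt h

theorem differentiableOn_chordGlue (H : ChordSetting f δ ε α) :
    DifferentiableOn ℂ (chordGlue f ε α) disc := fun z hz => by
  refine DifferentiableAt.differentiableWithinAt ?_
  by_cases hV : z ∈ disc ∩ ball 1 ε
  · have hn := (isOpen_disc_inter_ball ε).mem_nhds hV
    refine (H.differentiableOn_chordExt.differentiableAt hn).congr_of_eventuallyEq ?_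
    filter_upwards [hn] with y hy
    rw [chordGlue, if_pos hy]
  · have hlt : z.re < Real.cos α := by
      by_contra hc
      exact hV (H.mem_nhd_of_cos_le hz (not_lt.1 hc))
    refine (H.differentiableAt_chordCauchy hlt.ne).congr_of_eventuallyEq ?_
    filter_upwards [eventually_re_lt hlt] with y hy using H.chordGlue_of_lt hy

theorem norm_chordGlue_le (H : ChordSetting f δ ε α) {z : ℂ} (hz : z ∈ disc) :
    ‖chordGlue f ε α z‖ ≤ 84 / δ + 6 / (δ * ε) := by
  have hδ := H.delta_pos
  have hε := H.eps_pos
  by_cases hV : z ∈ disc ∩ ball 1 ε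
  · rw [chordGlue, if_pos hV]
    exact (H.norm_chordExt_le hV).trans (le_add_of_nonneg_right (by positivity))
  · rw [chordGlue, if_neg hV]
    have hfar : ε ≤ ‖z - 1‖ := by
      by_contra hc
      exact hV ⟨hz, mem_ball_iff_norm.2 (not_le.1 hc)⟩
    have h := (H.chordCauchy_bounds (z := z) (r := 2 / 3 * ε) (by positivity) fun t ht => by
      have h1 := H.norm_chord_sub_one_le ht
      have h2 := norm_sub_le_norm_sub_add_norm_sub z (chord α t) 1
      rw [norm_sub_rev z (chord α t)] at h2
      linarith [H.alpha_le]).2.1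
    refine h.trans (le_add_of_nonneg_of_le (by positivity) (le_of_eq ?_))
    field_simp
    norm_num

theorem norm_deriv_chordQuot_le (H : ChordSetting f δ ε α) {z : ℂ}
    (hz : z ∈ disc ∩ ball 1 ε) :
    ‖deriv (chordQuot f α) z‖ ≤ 4 / δ + 4 / δ ^ 2 * ‖deriv f z‖ := by
  have hδ := H.delta_pos
  have hfz := H.le_norm z hz
  have hf0 : f z ≠ 0 := fun h => by rw [h, norm_zero] at hfz; linarith
  have h : HasDerivAt (chordQuot f α) (deriv (chordPoly α) z / f z -
      chordPoly α z * deriv f z / f z ^ 2) z := by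
    have := (differentiable_chordPoly α z).hasDerivAt.div
      (H.differentiableOn.differentiableAt (isOpen_disc.mem_nhds hz.1)).hasDerivAt hf0
    refine HasDerivAt.congr_deriv (f := chordQuot f α) this ?_
    field_simp
  rw [h.deriv]
  refine (norm_sub_le _ _).trans (add_le_add ?_ ?_)
  · rw [norm_div]
    exact div_le_div₀ (by norm_num) (norm_deriv_chordPoly_le α hz.1) hδ hfz
  · rw [norm_div, norm_mul, norm_pow, div_mul_eq_mul_div]
    have := norm_chordPoly_le α hz.1
    gcongr

theorem norm_chordPoly_sq_mul_deriv_chordGlue_le (H : ChordSetting f δ ε α) :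
    ∃ M : ℝ, 0 ≤ M ∧ ∀ z ∈ disc,
      ‖chordPoly α z ^ 2 * deriv (chordGlue f ε α) z‖ ≤ M * (1 + ‖deriv f z‖) := by
  have hδ := H.delta_pos
  have hε := H.eps_pos
  set S := 84 / δ + 6 / (δ * ε) with hS
  have hS0 : 0 ≤ S := by positivity
  refine ⟨32 * S + 2304 / δ + 7 * 16 * (4 / δ + 4 / δ ^ 2), by positivity, fun z hz => ?_⟩
  set P := ‖chordPoly α z‖ with hP
  have hP0 : 0 ≤ P := norm_nonneg _
  have hP4 : P ≤ 4 := norm_chordPoly_le α hz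
  have hF := norm_nonneg (deriv f z)
  rcases hP0.eq_or_lt with h0 | h0
  · rw [norm_mul, norm_pow, ← hP, ← h0]
    simp only [ne_eq, OfNat.ofNat_ne_zero, not_false_eq_true, zero_pow, zero_mul]
    positivity
  rw [norm_mul, norm_pow, ← hP]
  have hM1 : 32 * S + 2304 / δ + 7 * 16 * (4 / δ + 4 / δ ^ 2) * (1 + ‖deriv f z‖) ≤
      (32 * S + 2304 / δ + 7 * 16 * (4 / δ + 4 / δ ^ 2)) * (1 + ‖deriv f z‖) := by
    have : 0 ≤ (32 * S + 2304 / δ) * ‖deriv f z‖ := by positivity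
    linarith
  have hQ : 0 ≤ 7 * 16 * (4 / δ + 4 / δ ^ 2) * (1 + ‖deriv f z‖) := by positivity
  refine le_trans ?_ hM1
  rcases le_or_gt (P / 4) (1 - ‖z‖) with hcase | hcase
  · have hd := norm_deriv_le_of_closedBall_subset H.differentiableOn_chordGlue
      (fun y hy => H.norm_chordGlue_le hy) (R := P / 8) (z := z) (by linarith) (fun y hy => by
        have h1 := mem_closedBall_iff_norm.1 hy
        have h2 := norm_le_norm_add_norm_sub' y z
        exact mem_disc.2 (by linarith))
    calc P ^ 2 * ‖deriv (chordGlue f ε α) z‖ ≤ P ^ 2 * (S / (P / 8)) := by gcongr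
      _ = 8 * P * S := by field_simp
      _ ≤ 32 * S := by nlinarith
      _ ≤ _ := by have : 0 ≤ 2304 / δ := by positivity
                  linarith
  · have hfar : ∀ t ∈ Ioo (-1 : ℝ) 1, P / 12 ≤ ‖chord α t - z‖ := fun t ht => by
      by_contra hc
      push Not at hc
      have h1 := norm_chordPoly_sub_le α hz (H.chord_mem_disc ht)
      have h2 := norm_sub_norm_le (chordPoly α z) (chordPoly α (chord α t))
      have h3 := H.norm_chord_le ht
      have h4 := norm_le_norm_add_norm_sub' z (chord α t)
      rw [norm_sub_rev] at hc
      linarith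
    have hne : z.re ≠ Real.cos α := fun h => by
      obtain ⟨t, ht, rfl⟩ := H.exists_chord_eq hz h
      have := hfar t ht
      rw [sub_self, norm_zero] at this
      linarith
    obtain ⟨hd, -, hb⟩ := H.chordCauchy_bounds (by linarith) hfar
    have hb' : P ^ 2 * ‖deriv (chordCauchy f α) z‖ ≤ 2304 / δ := by
      calc _ ≤ P ^ 2 * (16 / (δ * (P / 12) ^ 2)) := by gcongr
        _ = _ := by field_simp; norm_num
    rcases hne.lt_or_gt with hlt | hgt
    · have he : chordGlue f ε α =ᶠ[𝓝 z] chordCauchy f α := by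
        filter_upwards [eventually_re_lt hlt] with y hy using H.chordGlue_of_lt hy
      rw [he.deriv_eq]
      have : 0 ≤ 32 * S := by positivity
      linarith
    · have he : chordGlue f ε α =ᶠ[𝓝 z]
          fun y => chordCauchy f α y + 2 * Real.pi * I * chordQuot f α y := by
        filter_upwards [eventually_lt_re hgt, isOpen_disc.mem_nhds hz] with y hy hy'
          using H.chordGlue_of_gt hy' hy
      have hV := H.mem_nhd_of_cos_le hz hgt.le
      have hq := H.differentiableOn_chordQuot.differentiableAt
        ((isOpen_disc_inter_ball ε).mem_nhds hV)
      rw [he.deriv_eq, deriv_fun_add hd (hq.const_mul _), deriv_const_mul_field]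
      have hq' := H.norm_deriv_chordQuot_le hV
      have hpi : ‖(2 * Real.pi * I : ℂ)‖ ≤ 7 := by
        rw [norm_mul, norm_mul, norm_I, norm_real, Real.norm_of_nonneg Real.pi_pos.le]
        norm_num
        linarith [Real.pi_lt_d2]
      calc P ^ 2 * ‖deriv (chordCauchy f α) z + 2 * Real.pi * I * deriv (chordQuot f α) z‖
          ≤ P ^ 2 * (‖deriv (chordCauchy f α) z‖ + 7 * ‖deriv (chordQuot f α) z‖) := by
            gcongr
            refine (norm_add_le _ _).trans ?_
            rw [norm_mul]
            gcongr
        _ = P ^ 2 * ‖deriv (chordCauchy f α) z‖ + 7 * P ^ 2 * ‖deriv (chordQuot f α) z‖ := by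
            ring
        _ ≤ 2304 / δ + 7 * 4 ^ 2 * (4 / δ + 4 / δ ^ 2 * ‖deriv f z‖) := by gcongr
        _ ≤ _ := by
            have h1 : 0 ≤ 32 * S := by positivity
            have h2 : 0 ≤ 4 / δ * ‖deriv f z‖ := by positivity
            have h3 : 0 ≤ 4 / δ ^ 2 := by positivity
            linarith

end ChordSetting

/-- `q` is holomorphic and bounded on `s`, with derivative dominated by that of `f`. -/
def TameOn (f : ℂ → ℂ) (s : Set ℂ) (q : ℂ → ℂ) : Prop :=
  DifferentiableOn ℂ q s ∧
    ∃ M : ℝ, 0 ≤ M ∧ ∀ z ∈ s, ‖q z‖ ≤ M ∧ ‖deriv q z‖ ≤ M * (1 + ‖deriv f z‖)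

namespace TameOn

variable {f p q : ℂ → ℂ} {s t : Set ℂ}

theorem mono (h : TameOn f t q) (hst : s ⊆ t) : TameOn f s q :=
  ⟨h.1.mono hst, h.2.imp fun _ hM => ⟨hM.1, fun z hz => hM.2 z (hst hz)⟩⟩

theorem congr (hs : IsOpen s) (h : TameOn f s q) (he : EqOn p q s) : TameOn f s p := by
  obtain ⟨hd, M, hM, hb⟩ := h
  refine ⟨hd.congr he, M, hM, fun z hz => ?_⟩
  rw [he hz, (he.eventuallyEq_of_mem (hs.mem_nhds hz)).deriv_eq]
  exact hb z hz

theorem union (hs : IsOpen s) (ht : IsOpen t) (h : TameOn f s q) (h' : TameOn f t q) :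
    TameOn f (s ∪ t) q := by
  obtain ⟨hd, M, hM, hb⟩ := h
  obtain ⟨hd', M', hM', hb'⟩ := h'
  refine ⟨hd.union_of_isOpen hd' hs ht, max M M', hM.trans (le_max_left _ _), ?_⟩
  rintro z (hz | hz)
  · refine ⟨(hb z hz).1.trans (le_max_left _ _), (hb z hz).2.trans ?_⟩
    gcongr
    exact le_max_left _ _
  · refine ⟨(hb' z hz).1.trans (le_max_right _ _), (hb' z hz).2.trans ?_⟩
    gcongr
    exact le_max_right _ _

theorem const (c : ℂ) : TameOn f s (fun _ => c) :=
  ⟨differentiableOn_const c, ‖c‖, norm_nonneg c, fun z _ => ⟨le_rfl, by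
    rw [deriv_const, norm_zero]; positivity⟩⟩

theorem add (hs : IsOpen s) (h : TameOn f s p) (h' : TameOn f s q) :
    TameOn f s (fun z => p z + q z) := by
  obtain ⟨hd, M, hM, hb⟩ := h
  obtain ⟨hd', M', hM', hb'⟩ := h'
  refine ⟨hd.add hd', M + M', add_nonneg hM hM', fun z hz => ⟨?_, ?_⟩⟩
  · exact (norm_add_le _ _).trans (add_le_add (hb z hz).1 (hb' z hz).1)
  · have hn := hs.mem_nhds hz
    rw [deriv_fun_add (hd.differentiableAt hn) (hd'.differentiableAt hn), add_mul]
    exact (norm_add_le _ _).trans (add_le_add (hb z hz).2 (hb' z hz).2)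

theorem mul (hs : IsOpen s) (h : TameOn f s p) (h' : TameOn f s q) :
    TameOn f s (fun z => p z * q z) := by
  obtain ⟨hd, M, hM, hb⟩ := h
  obtain ⟨hd', M', hM', hb'⟩ := h'
  refine ⟨hd.mul hd', 2 * (M * M'), by positivity, fun z hz => ?_⟩
  obtain ⟨h1, h2⟩ := hb z hz
  obtain ⟨h1', h2'⟩ := hb' z hz
  have h3 : ‖p z * q z‖ ≤ M * M' := by rw [norm_mul]; gcongr
  refine ⟨h3.trans (by nlinarith [mul_nonneg hM hM']), ?_⟩
  have hn := hs.mem_nhds hz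
  rw [deriv_fun_mul (hd.differentiableAt hn) (hd'.differentiableAt hn)]
  calc _ ≤ M * (1 + ‖deriv f z‖) * M' + M * (M' * (1 + ‖deriv f z‖)) := by
        refine (norm_add_le _ _).trans ?_
        rw [norm_mul, norm_mul]
        gcongr
    _ = _ := by ring

theorem self (hs : DifferentiableOn ℂ f s) {N : ℝ} (hN : ∀ z ∈ s, ‖f z‖ ≤ N) : TameOn f s f :=
  ⟨hs, max N 1, zero_le_one.trans (le_max_right _ _), fun z hz =>
    ⟨(hN z hz).trans (le_max_left _ _), by
      have := norm_nonneg (deriv f z)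
      nlinarith [le_max_right N 1]⟩⟩

theorem of_bounds (hs : DifferentiableOn ℂ q s) {N N' : ℝ} (hN : ∀ z ∈ s, ‖q z‖ ≤ N)
    (hN' : ∀ z ∈ s, ‖deriv q z‖ ≤ N') : TameOn f s q := by
  refine ⟨hs, max (max N N') 0, le_max_right _ _, fun z hz => ⟨?_, ?_⟩⟩
  · exact (hN z hz).trans ((le_max_left _ _).trans (le_max_left _ _))
  · refine (hN' z hz).trans (((le_max_right N N').trans (le_max_left _ 0)).trans ?_)
    exact le_mul_of_one_le_right (le_max_right _ _) (by linarith [norm_nonneg (deriv f z)])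

theorem of_isCompact {U K : Set ℂ} (hU : IsOpen U) (hq : DifferentiableOn ℂ q U)
    (hK : IsCompact K) (hKU : K ⊆ U) : TameOn f K q := by
  obtain ⟨N, hN⟩ := hK.exists_bound_of_continuousOn (hq.continuousOn.mono hKU)
  obtain ⟨N', hN'⟩ := hK.exists_bound_of_continuousOn
    ((hq.deriv hU).continuousOn.mono hKU)
  exact of_bounds (hq.mono hKU) hN hN'

end TameOn

theorem tameOn_inv_sub_one {f : ℂ → ℂ} {η : ℝ} (hη : 0 < η) :
    TameOn f {z | η < ‖z - 1‖} (fun z => (z - 1)⁻¹) := by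
  have hne : ∀ z : ℂ, η < ‖z - 1‖ → z - 1 ≠ 0 := fun z hz h => by
    rw [h, norm_zero] at hz
    linarith
  have hd : ∀ z : ℂ, η < ‖z - 1‖ →
      HasDerivAt (fun z : ℂ => (z - 1)⁻¹) (-1 / (z - 1) ^ 2) z := fun z hz =>
    ((hasDerivAt_id z).sub_const 1).fun_inv (hne z hz)
  refine TameOn.of_bounds (N := η⁻¹) (N' := (η ^ 2)⁻¹)
    (fun z hz => (hd z hz).differentiableAt.differentiableWithinAt) ?_ ?_ <;>
  intro z (hz : η < ‖z - 1‖)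
  · rw [norm_inv]
    exact inv_anti₀ hη hz.le
  · rw [(hd z hz).deriv, norm_div, norm_neg, norm_one, norm_pow, one_div]
    gcongr

theorem ChordSetting.tameOn_sq_mul {f : ℂ → ℂ} {δ ε α : ℝ} (H : ChordSetting f δ ε α) (c : ℂ) :
    TameOn f disc (fun z => chordPoly α z ^ 2 * (chordGlue f ε α z + c)) := by
  have hp : TameOn f disc (chordPoly α) :=
    .of_bounds (differentiable_chordPoly α).differentiableOn
      (fun z hz => norm_chordPoly_le α hz) fun z hz => norm_deriv_chordPoly_le α hz
  have hg : TameOn f disc (fun z => chordPoly α z ^ 2 * chordGlue f ε α z) := by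
    obtain ⟨M, hM, hb⟩ := H.norm_chordPoly_sq_mul_deriv_chordGlue_le
    have hδ := H.delta_pos
    have hε := H.eps_pos
    have hS0 : 0 ≤ 84 / δ + 6 / (δ * ε) := by positivity
    set S := 84 / δ + 6 / (δ * ε) with hS
    have hd := differentiable_chordPoly α
    refine ⟨(hd.pow 2).differentiableOn.mul H.differentiableOn_chordGlue, 32 * S + M,
      by positivity, fun z hz => ⟨?_, ?_⟩⟩
    · rw [norm_mul, norm_pow]
      calc _ ≤ 4 ^ 2 * S := by
            gcongr
            exacts [norm_chordPoly_le α hz, H.norm_chordGlue_le hz]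
        _ ≤ _ := by linarith
    · have h1 : deriv (fun z => chordPoly α z ^ 2 * chordGlue f ε α z) z =
          2 * chordPoly α z * deriv (chordPoly α) z * chordGlue f ε α z +
            chordPoly α z ^ 2 * deriv (chordGlue f ε α) z := by
        have := ((hd z).hasDerivAt.pow 2).mul (H.differentiableOn_chordGlue.differentiableAt
          (isOpen_disc.mem_nhds hz)).hasDerivAt
        refine (HasDerivAt.deriv (f := fun z => chordPoly α z ^ 2 * chordGlue f ε α z)
          this).trans ?_
        simp
      rw [h1]
      have h2 := norm_nonneg (deriv f z)
      calc _ ≤ 2 * 4 * 4 * S + M * (1 + ‖deriv f z‖) := by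
            refine (norm_add_le _ _).trans (add_le_add ?_ (hb z hz))
            rw [norm_mul, norm_mul, norm_mul, Complex.norm_ofNat]
            gcongr
            exacts [norm_chordPoly_le α hz, norm_deriv_chordPoly_le α hz,
              H.norm_chordGlue_le hz]
        _ ≤ _ := by nlinarith
  refine (hg.add isOpen_disc ((hp.mul isOpen_disc hp).mul isOpen_disc (.const c))).congr
    isOpen_disc fun z _ => ?_
  ring

theorem exists_bezout_one {f : ℂ → ℂ} {N δ ε : ℝ} (hf : DifferentiableOn ℂ f disc)
    (hN : ∀ z ∈ disc, ‖f z‖ ≤ N) (hδ : 0 < δ) (hε : 0 < ε)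
    (hlow : ∀ z ∈ disc ∩ ball 1 ε, δ ≤ ‖f z‖) :
    ∃ (h k : ℂ → ℂ) (c : ℂ), c ≠ 0 ∧ TameOn f disc h ∧ TameOn f disc k ∧
      ∀ z ∈ disc, h z * f z + (z - 1) * k z = c := by
  set α := min (ε / 4) (1 / 2) with hα
  have H : ChordSetting f δ ε α :=
    { differentiableOn := hf
      delta_pos := hδ
      le_norm := hlow
      alpha_pos := by positivity
      alpha_lt_one := (min_le_right _ _).trans_lt (by norm_num)
      alpha_le := by linarith [min_le_left (ε / 4) (1 / 2)] }
  set C := chordCauchy f α with hC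
  set p := chordPoly α with hp
  set η := (1 - Real.cos α) / 2 with hη
  have hη0 : 0 < η := by linarith [H.cos_lt_one]
  have hκ : (Real.cos α : ℂ) = 1 - 2 * η := by rw [hη]; push_cast; ring
  have hp1 : p 1 ≠ 0 := by
    rw [hp, chordPoly, hκ]
    have : ((1 : ℂ) ^ 2 - 2 * (1 - 2 * η) * 1 + 1) = 4 * η := by ring
    rw [this]
    exact mul_ne_zero (by norm_num) (by exact_mod_cast hη0.ne')
  set h : ℂ → ℂ := fun z => p z ^ 2 * (chordGlue f ε α z + -C 1) with hh
  set c : ℂ := 2 * Real.pi * I * p 1 ^ 3 with hc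
  have hh_tame : TameOn f disc h := H.tameOn_sq_mul _
  have hf_tame : TameOn f disc f := .self hf hN
  have hcont : Continuous fun z : ℂ => ‖z - 1‖ := by fun_prop
  refine ⟨h, fun z => (c + -1 * (h z * f z)) * (z - 1)⁻¹, c,
    mul_ne_zero Complex.two_pi_I_ne_zero (pow_ne_zero 3 hp1), hh_tame, ?_, fun z hz => ?_⟩
  swap
  · have : z - 1 ≠ 0 := fun h => by
      rw [sub_eq_zero] at h
      simp [mem_disc, h] at hz
    field_simp
    ring
  have hs1 : IsOpen (disc ∩ {z | η / 2 < ‖z - 1‖}) :=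
    isOpen_disc.inter (isOpen_lt continuous_const hcont)
  have hs2 : IsOpen (disc ∩ ball (1 : ℂ) η) := isOpen_disc.inter isOpen_ball
  have hcover : disc ⊆ (disc ∩ {z | η / 2 < ‖z - 1‖}) ∪ (disc ∩ ball (1 : ℂ) η) := fun z hz => by
    rcases lt_or_ge (η / 2) ‖z - 1‖ with h | h
    · exact Or.inl ⟨hz, h⟩
    · exact Or.inr ⟨hz, mem_ball_iff_norm.2 (by linarith)⟩
  refine (TameOn.union hs1 hs2 ?_ ?_).mono hcover
  · exact ((TameOn.const c).add hs1 ((TameOn.const (-1)).mul hs1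
      ((hh_tame.mul isOpen_disc hf_tame).mono inter_subset_left))).mul hs1
      ((tameOn_inv_sub_one (by linarith)).mono inter_subset_right)
  · have hre : ∀ z ∈ ball (1 : ℂ) (2 * η), Real.cos α < z.re := fun z hz => by
      have h1 := mem_ball_iff_norm.1 hz
      have h2 := abs_le.1 (abs_re_le_norm (z - 1))
      rw [sub_re, one_re] at h2
      linarith
    have hCd : DifferentiableOn ℂ C (ball 1 (2 * η)) := fun z hz =>
      (H.differentiableAt_chordCauchy (hre z hz).ne').differentiableWithinAt
    have hnhds : ball (1 : ℂ) (2 * η) ∈ 𝓝 1 := ball_mem_nhds _ (by linarith)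
    have hsub : closedBall (1 : ℂ) η ⊆ ball 1 (2 * η) := closedBall_subset_ball (by linarith)
    have hsub' : disc ∩ ball (1 : ℂ) η ⊆ closedBall 1 η :=
      inter_subset_right.trans ball_subset_closedBall
    have hds : ∀ {q : ℂ → ℂ}, DifferentiableOn ℂ q (ball 1 (2 * η)) →
        TameOn f (disc ∩ ball (1 : ℂ) η) (dslope q 1) := fun hq =>
      (TameOn.of_isCompact isOpen_ball ((Complex.differentiableOn_dslope hnhds).2 hq)
        (isCompact_closedBall 1 η) hsub).mono hsub'
    have hpd := differentiable_chordPoly α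
    have t1 := hds hCd
    have t2 := hds (hpd.pow 3).differentiableOn
    have t3 : TameOn f (disc ∩ ball (1 : ℂ) η) p :=
      (TameOn.of_isCompact isOpen_univ hpd.differentiableOn (isCompact_closedBall 1 η)
        (subset_univ _)).mono hsub'
    have t4 := hf_tame.mono (inter_subset_left (t := ball (1 : ℂ) η))
    refine (((TameOn.const (-(2 * Real.pi * I))).mul hs2 t2).add hs2
      ((TameOn.const (-1)).mul hs2 (((t3.mul hs2 t3).mul hs2 t4).mul hs2 t1))).congr hs2 ?_
    rintro z ⟨hz, hzη⟩
    have hz1 : z ≠ 1 := fun h => by simp [mem_disc, h] at hz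
    have hz1' := sub_ne_zero.2 hz1
    have hgt := hre z (hsub (ball_subset_closedBall hzη))
    have hf0 : f z ≠ 0 := fun h0 => by
      have := hlow z (H.mem_nhd_of_cos_le hz hgt.le)
      rw [h0, norm_zero] at this
      linarith
    simp only [hh, dslope_of_ne _ hz1, slope_def_field, H.chordGlue_of_gt hz hgt, chordQuot, hc,
      Pi.pow_apply]
    field_simp
    ring

theorem nhdsWithin_disc_neBot {ζ : ℂ} (hζ : ‖ζ‖ = 1) : (𝓝[disc] ζ).NeBot := by
  rw [← mem_closure_iff_nhdsWithin_neBot, disc, closure_ball _ one_ne_zero]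
  exact mem_closedBall_zero_iff.2 hζ.le

theorem exists_le_norm_of_notMem_zlow {f : ℂ → ℂ} {N : ℝ} (hN : ∀ z ∈ disc, ‖f z‖ ≤ N) {ζ : ℂ}
    (hζ : ‖ζ‖ = 1) (h : ζ ∉ Zlow f) :
    ∃ δ > 0, ∃ ε > 0, ∀ z ∈ disc, ‖z - ζ‖ < ε → δ ≤ ‖f z‖ := by
  have := nhdsWithin_disc_neBot hζ
  have hlow : (𝓝[disc] ζ).IsBoundedUnder (· ≥ ·) fun z => ‖f z‖ :=
    isBoundedUnder_of_eventually_ge (a := 0) (.of_forall fun z => norm_nonneg _)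
  have hup : (𝓝[disc] ζ).IsCoboundedUnder (· ≥ ·) fun z => ‖f z‖ :=
    (isBoundedUnder_of_eventually_le (a := N)
      (eventually_mem_nhdsWithin.mono hN)).isCoboundedUnder_ge
  have h0 : 0 ≤ liminf (fun z => ‖f z‖) (𝓝[disc] ζ) :=
    le_liminf_of_le hup (.of_forall fun z => norm_nonneg _)
  have hne : liminf (fun z => ‖f z‖) (𝓝[disc] ζ) ≠ 0 := fun h1 =>
    h ⟨mem_closedBall_zero_iff.2 hζ.le, h1⟩
  have hpos := lt_of_le_of_ne h0 hne.symm
  obtain ⟨ε, hε, hb⟩ := mem_nhdsWithin_iff.1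
    (eventually_lt_of_lt_liminf (half_lt_self hpos) hlow)
  exact ⟨_, half_pos hpos, ε, hε, fun z hz hzε => le_of_lt (hb ⟨mem_ball_iff_norm.2 hzε, hz⟩)⟩

theorem mul_mem_disc_iff {c z : ℂ} (hc : ‖c‖ = 1) : c * z ∈ disc ↔ z ∈ disc := by
  rw [mem_disc, mem_disc, norm_mul, hc, one_mul]

theorem memA_comp_rotation {μ : Measure ℂ} [IsFiniteMeasure μ] (hμ : OnCircle μ) {f q : ℂ → ℂ}
    (hf : MemA μ f) {ζ : ℂ} (hζ : ‖ζ‖ = 1) (hq : TameOn (fun z => f (ζ * z)) disc q) :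
    MemA μ (fun z => q (ζ⁻¹ * z)) := by
  obtain ⟨hd, M, hM, hb⟩ := hq
  have hζ0 : ζ ≠ 0 := fun h => by simp [h] at hζ
  have hi : ‖ζ⁻¹‖ = 1 := by rw [norm_inv, hζ, inv_one]
  refine (memA_of_bounds hμ (F := fun z => q (ζ⁻¹ * z)) hf
    (hd.comp (differentiable_id.const_mul _).differentiableOn
      fun z hz => (mul_mem_disc_iff hi).2 hz) (M := M) (fun z hz => ?_) fun z hz => ?_).1
  · exact (hb _ ((mul_mem_disc_iff hi).2 hz)).1
  · have := (hb _ ((mul_mem_disc_iff hi).2 hz)).2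
    rw [deriv_comp_mul_left, norm_smul, hζ, one_mul, mul_inv_cancel_left₀ hζ0] at this
    rw [deriv_comp_mul_left, norm_smul, hi, one_mul]
    exact this

theorem exists_memA_bezout {μ : Measure ℂ} [IsFiniteMeasure μ] (hμ : OnCircle μ) {f : ℂ → ℂ}
    (hf : MemA μ f) {ζ : ℂ} (hζ : ‖ζ‖ = 1) (hz : ζ ∉ Zlow f) :
    ∃ (h k : ℂ → ℂ) (c : ℂ), c ≠ 0 ∧ MemA μ h ∧ MemA μ k ∧
      ∀ z ∈ disc, h z * f z + (z - ζ) * k z = c := by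
  obtain ⟨hd, N, hN⟩ := hf.2
  obtain ⟨δ, hδ, ε, hε, hlow⟩ := exists_le_norm_of_notMem_zlow hN hζ hz
  have hζ0 : ζ ≠ 0 := fun h => by simp [h] at hζ
  have hi : ‖ζ⁻¹‖ = 1 := by rw [norm_inv, hζ, inv_one]
  obtain ⟨h, k, c, hc, hh, hk, hB⟩ := exists_bezout_one (f := fun z => f (ζ * z)) (N := N)
    (hd.comp (differentiable_id.const_mul _).differentiableOn
      fun z hz => (mul_mem_disc_iff hζ).2 hz)
    (fun z hz => hN _ ((mul_mem_disc_iff hζ).2 hz)) hδ hε fun z hz => by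
      refine hlow _ ((mul_mem_disc_iff hζ).2 hz.1) ?_
      have : ζ * z - ζ = ζ * (z - 1) := by ring
      rw [this, norm_mul, hζ, one_mul]
      exact mem_ball_iff_norm.1 hz.2
  refine ⟨fun z => h (ζ⁻¹ * z), fun z => ζ⁻¹ * k (ζ⁻¹ * z), c, hc,
    memA_comp_rotation hμ hf hζ hh,
    memA_comp_rotation hμ hf hζ (q := fun z => ζ⁻¹ * k z)
      ((TameOn.const ζ⁻¹).mul isOpen_disc hk), fun z hz => ?_⟩
  have := hB _ ((mul_mem_disc_iff hi).2 hz)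
  rw [mul_inv_cancel_left₀ hζ0] at this
  rw [← this]
  field_simp

section LinearResolvent

variable {μ : Measure ℂ} [IsFiniteMeasure μ] {hμ : OnCircle μ} {J : Set (ℂ → ℂ)}
  {B : Type} [NormedCommRing B] [NormedAlgebra ℂ B] {π : BoundedDirichlet hμ →ₐ[ℂ] B}

/-- The function `1 - z / ζ`. -/
def linearFactor (hμ : OnCircle μ) (ζ : ℂ) : BoundedDirichlet hμ :=
  ⟨fun z => 1 + -ζ⁻¹ * z, (memA_add hμ (memA_const hμ 1)
    (memA_mul hμ (memA_const hμ (-ζ⁻¹)) (memA_id hμ)).1).1⟩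

theorem map_eq_of_eqOn (hπ : ∀ f, ‖π f‖ ≤ algNorm μ f.1) {f g : BoundedDirichlet hμ}
    (h : ∀ z ∈ disc, f.1 z = g.1 z) : π f = π g := by
  rw [← sub_eq_zero, ← map_sub, ← norm_le_zero_iff]
  have h0 : algNorm μ (f - g).1 = algNorm μ (fun _ => 0) :=
    algNorm_congr fun z hz => sub_eq_zero.2 (h z hz)
  exact (hπ (f - g)).trans (h0.trans (by rw [algNorm_const, norm_zero])).le

theorem resolvent_of_inverse_mod (hπ : ∀ f, ‖π f‖ ≤ algNorm μ f.1)
    (hker : ∀ f, π f = 0 ↔ f.1 ∈ J) {ζ u : ℂ} {g j : ℂ → ℂ} (hg : MemA μ g) (hj : MemA μ j)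
    (hjJ : j ∈ J) (h : ∀ z ∈ disc, (1 - u * (1 + -ζ⁻¹ * z)) * g z + j z = 1) :
    IsUnit (1 - u • π (linearFactor hμ ζ)) ∧
      ‖entireResolvent (π (linearFactor hμ ζ)) u‖ ≤ algNorm μ g := by
  set a : BoundedDirichlet hμ := 1 - u • linearFactor hμ ζ with ha
  have h1 : π a = 1 - u • π (linearFactor hμ ζ) := by rw [ha, map_sub, map_one, map_smul]
  let G : BoundedDirichlet hμ := ⟨g, hg⟩
  let L : BoundedDirichlet hμ := ⟨j, hj⟩
  have h2 : π (a * G + L) = π 1 := map_eq_of_eqOn hπ h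
  rw [map_add, (hker L).2 hjJ, add_zero, map_mul, map_one, h1] at h2
  refine ⟨IsUnit.of_mul_eq_one _ h2, ?_⟩
  have h3 : entireResolvent (π (linearFactor hμ ζ)) u = π G :=
    Ring.inverse_unit (Units.mkOfMulEqOne _ _ h2)
  rw [h3]
  exact hπ _

theorem resolvent_left (hπ : ∀ f, ‖π f‖ ≤ algNorm μ f.1) (hker : ∀ f, π f = 0 ↔ f.1 ∈ J)
    (hJ : ClosedIdeal μ J) {ζ u : ℂ} (hζ : ‖ζ‖ = 1) (hu : u.re < 1 / 2) :
    IsUnit (1 - u • π (linearFactor hμ ζ)) ∧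
      ∃ D, 0 ≤ D ∧ D ≤ (1 + 2 * ‖u‖) / (2 * (1 / 2 - u.re)) ∧
        ‖entireResolvent (π (linearFactor hμ ζ)) u‖ ≤
          (D + ‖u‖ * D ^ 2) * normConst μ (fun z => z) := by
  have hsq : ‖1 - u‖ ^ 2 - ‖u‖ ^ 2 = 2 * (1 / 2 - u.re) := by
    rw [norm_sub_rev, norm_sub_one_sq]; ring
  have hlt : ‖u‖ < ‖1 - u‖ := lt_of_pow_lt_pow_left₀ 2 (norm_nonneg _) (by linarith)
  have hb : ‖u * ζ⁻¹‖ = ‖u‖ := by rw [norm_mul, norm_inv, hζ, inv_one, mul_one]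
  obtain ⟨hA, hn⟩ := memA_inv_linear (a := 1 - u) (b := u * ζ⁻¹) hμ (by rwa [hb])
  rw [hb] at hn
  have hne : ∀ z ∈ disc, 1 - u + u * ζ⁻¹ * z ≠ 0 := fun z hz h0 => by
    have h1 : ‖1 - u‖ = ‖u‖ * ‖z‖ := by
      rw [eq_neg_of_add_eq_zero_left h0, norm_neg, norm_mul, hb]
    nlinarith [mem_disc.1 hz, norm_nonneg u]
  obtain ⟨h1, h2⟩ := resolvent_of_inverse_mod (ζ := ζ) (u := u) hπ hker hA (memA_const hμ 0)
    hJ.zero_mem fun z hz => by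
      have e : 1 - u * (1 + -ζ⁻¹ * z) = 1 - u + u * ζ⁻¹ * z := by ring
      rw [add_zero, e, mul_inv_cancel₀ (hne z hz)]
  refine ⟨h1, (‖1 - u‖ - ‖u‖)⁻¹, inv_nonneg.2 (by linarith), ?_, h2.trans hn⟩
  have h3 : 0 < ‖1 - u‖ - ‖u‖ := by linarith
  have h4 : ‖1 - u‖ ≤ 1 + ‖u‖ := (norm_sub_le _ _).trans (by rw [norm_one])
  rw [inv_eq_one_div, div_le_div_iff₀ h3 (by linarith), ← hsq]
  nlinarith

theorem resolvent_right (hπ : ∀ f, ‖π f‖ ≤ algNorm μ f.1) (hker : ∀ f, π f = 0 ↔ f.1 ∈ J)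
    (hJ : ClosedIdeal μ J) {f : ℂ → ℂ} (hf : f ∈ J) {C : ℝ}
    (hC : ∀ lam ∈ disc, MemA μ (dslope f lam) ∧
      algNorm μ (dslope f lam) ≤ C / (1 - ‖lam‖) ^ 2) {ζ u : ℂ} (hζ : ‖ζ‖ = 1) (hu : u ≠ 0)
    (hlam : ζ * (1 - u⁻¹) ∈ disc) (hf0 : f (ζ * (1 - u⁻¹)) ≠ 0) :
    IsUnit (1 - u • π (linearFactor hμ ζ)) ∧
      ‖entireResolvent (π (linearFactor hμ ζ)) u‖ ≤
        ‖u‖⁻¹ * ‖(f (ζ * (1 - u⁻¹)))⁻¹‖ * (C / (1 - ‖ζ * (1 - u⁻¹)‖) ^ 2) := by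
  set lam := ζ * (1 - u⁻¹) with hl
  have hζ0 : ζ ≠ 0 := fun h => by simp [h] at hζ
  obtain ⟨hq, hqn⟩ := hC lam hlam
  set c : ℂ := -(ζ * u⁻¹ * (f lam)⁻¹) with hc
  have hcn : ‖c‖ = ‖u‖⁻¹ * ‖(f lam)⁻¹‖ := by
    rw [hc, norm_neg, norm_mul, norm_mul, hζ, one_mul, norm_inv u]
  obtain ⟨hg, hgn⟩ := memA_mul hμ (memA_const hμ c) hq
  rw [algNorm_const, hcn] at hgn
  have hj := hJ.mul_mem _ (memA_const hμ (f lam)⁻¹) f hf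
  obtain ⟨h1, h2⟩ := resolvent_of_inverse_mod (ζ := ζ) (u := u) hπ hker hg (hJ.subset hj) hj
    fun z _ => by
      have h3 : (z - lam) * dslope f lam z = f z - f lam := by
        rw [← smul_eq_mul, sub_smul_dslope]
      have h4 : 1 - u * (1 + -ζ⁻¹ * z) = u * ζ⁻¹ * (z - lam) := by
        rw [hl]; field_simp; ring
      rw [h4, hc]
      calc _ = -((u * u⁻¹) * (ζ⁻¹ * ζ) * (f lam)⁻¹ * ((z - lam) * dslope f lam z)) +
            (f lam)⁻¹ * f z := by ring
        _ = 1 := by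
          rw [h3, mul_inv_cancel₀ hu, inv_mul_cancel₀ hζ0]
          field_simp
          ring
  exact ⟨h1, h2.trans (hgn.trans (by gcongr))⟩

theorem isUnit_on_line (hπ : ∀ f, ‖π f‖ ≤ algNorm μ f.1) (hker : ∀ f, π f = 0 ↔ f.1 ∈ J)
    (hJ : ClosedIdeal μ J) {f : ℂ → ℂ} (hf : f ∈ J) {ζ u : ℂ} (hζ : ‖ζ‖ = 1) (hu : u ≠ 0)
    (hlam : ‖ζ * (1 - u⁻¹)‖ = 1) (hZ : ζ * (1 - u⁻¹) ∉ Zlow f) :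
    IsUnit (1 - u • π (linearFactor hμ ζ)) := by
  set lam := ζ * (1 - u⁻¹) with hl
  have hζ0 : ζ ≠ 0 := fun h => by simp [h] at hζ
  obtain ⟨h, k, c, hc, hh, hk, hB⟩ := exists_memA_bezout hμ (hJ.subset hf) hlam hZ
  have hj := hJ.mul_mem _ (memA_mul hμ (memA_const hμ c⁻¹) hh).1 f hf
  refine (resolvent_of_inverse_mod hπ hker
    (memA_mul hμ (memA_const hμ (ζ * u⁻¹ * c⁻¹)) hk).1 (hJ.subset hj) hj fun z hz => ?_).1
  have h4 : 1 - u * (1 + -ζ⁻¹ * z) = u * ζ⁻¹ * (z - lam) := by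
    rw [hl]; field_simp; ring
  rw [h4]
  calc _ = (u * u⁻¹) * (ζ⁻¹ * ζ) * c⁻¹ * ((z - lam) * k z) + c⁻¹ * (h z * f z) := by ring
    _ = c⁻¹ * (h z * f z + (z - lam) * k z) := by
      rw [mul_inv_cancel₀ hu, inv_mul_cancel₀ hζ0]; ring
    _ = 1 := by rw [hB z hz, inv_mul_cancel₀ hc]

theorem norm_sq_mul_one_sub {ζ u : ℂ} (hζ : ‖ζ‖ = 1) (hu : u ≠ 0) :
    ‖u‖ ^ 2 * (1 - ‖ζ * (1 - u⁻¹)‖ ^ 2) = 2 * (u.re - 1 / 2) := by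
  have h : ‖u‖ * ‖ζ * (1 - u⁻¹)‖ = ‖u - 1‖ := by
    rw [norm_mul, hζ, one_mul, ← norm_mul, mul_sub, mul_one, mul_inv_cancel₀ hu]
  rw [mul_sub, mul_one, ← mul_pow, h, norm_sub_one_sq]
  ring

theorem linearFactor_pow_four (hπ : ∀ f, ‖π f‖ ≤ algNorm μ f.1)
    (hker : ∀ f, π f = 0 ↔ f.1 ∈ J) [CompleteSpace B] (hJ : ClosedIdeal μ J)
    (hout : ∃ f ∈ J, IsOuter f) {ζ : ℂ} (hζ : ‖ζ‖ = 1)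
    (hZ : ∀ w : ℂ, ‖w‖ = 1 → w ≠ ζ → ∃ f ∈ J, w ∉ Zlow f) :
    π (linearFactor hμ ζ) ^ 4 = 0 := by
  obtain ⟨f, hf, φ, hφ⟩ := hout
  have hζ0 : ζ ≠ 0 := fun h => by simp [h] at hζ
  obtain ⟨C, hC0, hC⟩ := exists_memA_dslope hμ (hJ.subset hf)
  obtain ⟨K₁, hK₁, hinv⟩ := hφ.exists_norm_inv_le
  set N := normConst μ (fun z => z) with hN
  have hN0 : 0 < N := normConst_pos _ _
  have hright : ∀ u : ℂ, 1 / 2 < u.re → u ≠ 0 ∧ ζ * (1 - u⁻¹) ∈ disc ∧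
      (u.re - 1 / 2) / ‖u‖ ^ 2 ≤ 1 - ‖ζ * (1 - u⁻¹)‖ := fun u hu => by
    have hu0 : u ≠ 0 := fun h => by rw [h, zero_re] at hu; linarith
    have h1 := norm_sq_mul_one_sub hζ hu0
    have h2 : 0 < ‖u‖ ^ 2 := by positivity
    set r := ‖ζ * (1 - u⁻¹)‖ with hr
    have hr0 : 0 ≤ r := norm_nonneg _
    have h3 : r < 1 := by
      by_contra hc
      push Not at hc
      have h4 : 1 - r ^ 2 ≤ 0 := by nlinarith
      have h5 := mul_nonpos_of_nonneg_of_nonpos h2.le h4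
      linarith
    refine ⟨hu0, mem_disc.2 h3, ?_⟩
    rw [div_le_iff₀ h2]
    nlinarith
  set K := 3 * N + 4 * C + K₁ + 1 with hK
  refine pow_four_eq_zero_of_growth _ (K := K) (fun u => ?_) (by positivity) (fun u hu => ?_)
    (fun u hu => ?_) (fun ε hε => ?_)
  · rcases lt_trichotomy u.re (1 / 2) with h | h | h
    · exact (resolvent_left hπ hker hJ hζ h).1
    · have hu0 : u ≠ 0 := fun h0 => by rw [h0, zero_re] at h; norm_num at h
      have h1 := norm_sq_mul_one_sub hζ hu0
      rw [h, sub_self, mul_zero, mul_eq_zero, sub_eq_zero] at h1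
      have h2 : ‖ζ * (1 - u⁻¹)‖ = 1 := by
        rcases h1 with h1 | h1
        · exact absurd h1 (by positivity)
        · exact (pow_eq_one_iff_of_nonneg (norm_nonneg _) two_ne_zero).1 h1.symm
      obtain ⟨F, hF, hFz⟩ := hZ _ h2 fun h3 => by
        have h4 := mul_left_cancel₀ hζ0 (h3.trans (mul_one ζ).symm)
        exact inv_ne_zero hu0 (sub_eq_self.1 h4)
      exact isUnit_on_line hπ hker hJ hF hζ hu0 h2 hFz
    · obtain ⟨hu0, hl, -⟩ := hright u h
      exact (resolvent_right hπ hker hJ hf hC hζ hu0 hl (hφ.ne_zero hl)).1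
  · have hsq : ∀ x : ℝ, 0 ≤ x → x ^ 2 ≤ 2 * Real.exp x := fun x hx => by
      linarith [Real.quadratic_le_exp_of_nonneg hx]
    set s := |u.re - 1 / 2| with hs
    have hs0 : 0 < s := abs_pos.2 (sub_ne_zero.2 hu)
    set x := (1 + ‖u‖ ^ 2) / s with hx
    have hx0 : 0 ≤ x := by positivity
    have hKx : K * (1 + ‖u‖ ^ 2) / s = K * x := by rw [hx, mul_div_assoc]
    rw [hKx]
    rcases hu.lt_or_gt with h | h
    · obtain ⟨-, D, hD0, hD, hb⟩ := resolvent_left hπ hker hJ hζ h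
      have hs' : 1 / 2 - u.re = s := by rw [hs, abs_of_neg (by linarith)]; ring
      rw [hs'] at hD
      have ha := norm_nonneg u
      have h1 : D ≤ x := hD.trans (by
        rw [hx, div_le_div_iff₀ (by positivity) hs0]
        nlinarith [sq_nonneg (‖u‖ - 1)])
      have h2 : ‖u‖ * D ^ 2 ≤ x ^ 2 := by
        calc ‖u‖ * D ^ 2 ≤ ‖u‖ * ((1 + 2 * ‖u‖) / (2 * s)) ^ 2 := by gcongr
          _ = (‖u‖ * (1 + 2 * ‖u‖) ^ 2 / 4) / s ^ 2 := by field_simp; norm_num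
          _ ≤ (1 + ‖u‖ ^ 2) ^ 2 / s ^ 2 := by
            gcongr
            nlinarith [sq_nonneg (‖u‖ ^ 2 - ‖u‖ / 2), sq_nonneg (‖u‖ - 1), sq_nonneg ‖u‖]
          _ = x ^ 2 := by rw [hx, div_pow]
      calc _ ≤ (x + x ^ 2) * N := hb.trans (by gcongr)
        _ ≤ (Real.exp x + 2 * Real.exp x) * N := by
          gcongr
          exacts [by linarith [Real.add_one_le_exp x], hsq x hx0]
        _ = 3 * N * Real.exp x := by ring
        _ ≤ K * Real.exp (K * x) := by
          gcongr
          · rw [hK]; linarith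
          · exact le_mul_of_one_le_left hx0 (by rw [hK]; linarith)
    · obtain ⟨hu0, hl, hd⟩ := hright u h
      have hb := (resolvent_right hπ hker hJ hf hC hζ hu0 hl (hφ.ne_zero hl)).2
      have hs' : u.re - 1 / 2 = s := by rw [hs, abs_of_pos (by linarith)]
      rw [hs'] at hd
      set r := ‖ζ * (1 - u⁻¹)‖ with hr
      have hun : 1 / 2 ≤ ‖u‖ := by linarith [re_le_norm u]
      have hu2 : 0 < ‖u‖ ^ 2 := by positivity
      set y := ‖u‖ ^ 2 / s with hy
      have hy0 : 0 < y := by positivity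
      have hyd : y⁻¹ ≤ 1 - r := by rw [hy, inv_div]; exact hd
      have hyi : 0 < y⁻¹ := by positivity
      have hyx : y ≤ x := by rw [hy, hx]; gcongr; linarith
      have h1 : ‖(f (ζ * (1 - u⁻¹)))⁻¹‖ ≤ Real.exp (K₁ * y) := by
        refine (hinv _ hl).trans (Real.exp_le_exp.2 ?_)
        rw [← hr]
        calc K₁ / (1 - r) ≤ K₁ / y⁻¹ := by gcongr
          _ = K₁ * y := by rw [div_inv_eq_mul]
      have h2 : C / (1 - r) ^ 2 ≤ C * y ^ 2 := by
        calc C / (1 - r) ^ 2 ≤ C / y⁻¹ ^ 2 := by gcongr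
          _ = C * y ^ 2 := by rw [inv_pow, div_inv_eq_mul]
      have h3 : ‖u‖⁻¹ ≤ 2 := by
        rw [inv_le_comm₀ (by linarith) (by norm_num)]; linarith
      calc _ ≤ 2 * Real.exp (K₁ * y) * (C * y ^ 2) := hb.trans (by gcongr)
        _ ≤ 2 * Real.exp (K₁ * y) * (C * (2 * Real.exp y)) := by gcongr; exact hsq y hy0.le
        _ = 4 * C * Real.exp ((K₁ + 1) * y) := by rw [add_mul, one_mul, Real.exp_add]; ring
        _ ≤ K * Real.exp (K * x) := by
          gcongr
          · rw [hK]; linarith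
          · rw [hK]; linarith
  · obtain ⟨-, D, hD0, hD, hb⟩ := resolvent_left hπ hker hJ hζ (by linarith : u.re < 1 / 2)
    have ha := norm_nonneg u
    have h1 : D ≤ 1 + ‖u‖ := hD.trans (by
      rw [div_le_iff₀ (by linarith)]
      nlinarith)
    calc _ ≤ ((1 + ‖u‖) + ‖u‖ * (1 + ‖u‖) ^ 2) * N := hb.trans (by gcongr)
      _ ≤ (2 * (1 + ‖u‖) ^ 3) * N := by
        gcongr
        nlinarith [pow_nonneg ha 3, pow_nonneg ha 2]
      _ = 2 * N * (1 + ‖u‖) ^ 3 := by ring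
      _ ≤ K * (1 + ‖u‖) ^ 3 := by gcongr; rw [hK]; linarith
  · obtain ⟨ρ, hρ1, hρ⟩ := (mem_nhdsLT_iff_exists_Ioo_subset' (by norm_num : (0 : ℝ) < 1)).1
      (hφ.norm_inv_radial_le hζ (half_pos hε))
    rw [mem_Iio] at hρ1
    set X := (1 - ρ)⁻¹ with hX
    have hXpos : 0 < X := inv_pos.2 (by linarith)
    have hb : ∀ x : ℝ, 1 ≤ x → ‖entireResolvent (π (linearFactor hμ ζ)) x‖ ≤
        C * x * ‖(f (((1 - x⁻¹ : ℝ) : ℂ) * ζ))⁻¹‖ ∧ ((1 - x⁻¹ : ℝ) : ℂ) * ζ ∈ disc ∧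
          ‖(f (((1 - x⁻¹ : ℝ) : ℂ) * ζ))⁻¹‖ ≤ Real.exp (K₁ * x) := fun x hx => by
      obtain ⟨hu0, hl, -⟩ := hright x (by rw [ofReal_re]; linarith)
      have hb := (resolvent_right hπ hker hJ hf hC hζ hu0 hl (hφ.ne_zero hl)).2
      have he : ζ * (1 - (x : ℂ)⁻¹) = ((1 - x⁻¹ : ℝ) : ℂ) * ζ := by push_cast; ring
      have hxi : x⁻¹ ≤ 1 := inv_le_one_of_one_le₀ hx
      have hn : 1 - ‖((1 - x⁻¹ : ℝ) : ℂ) * ζ‖ = x⁻¹ := by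
        rw [norm_mul, hζ, norm_real, Real.norm_of_nonneg (by linarith)]; ring
      rw [he] at hb hl
      have h5 := hinv _ hl
      rw [hn, div_inv_eq_mul] at h5
      rw [hn, norm_real, Real.norm_of_nonneg (by linarith)] at hb
      refine ⟨hb.trans (le_of_eq ?_), hl, h5⟩
      have : x ≠ 0 := by linarith
      field_simp
    refine ⟨C * (2 / ε) + C * X * Real.exp (K₁ * X), fun x hx => ?_⟩
    obtain ⟨h1, -, h2⟩ := hb x hx
    refine h1.trans ?_
    have hx0 : 0 < x := by linarith
    rcases le_or_gt x X with h | h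
    · calc C * x * ‖(f (((1 - x⁻¹ : ℝ) : ℂ) * ζ))⁻¹‖
          ≤ C * X * Real.exp (K₁ * X) := by
            gcongr
            exact h2.trans (by gcongr)
        _ ≤ C * (2 / ε) + C * X * Real.exp (K₁ * X) := le_add_of_nonneg_left (by positivity)
        _ ≤ _ := le_mul_of_one_le_right (by positivity) (Real.one_le_exp (by positivity))
    · have hxρ : 1 - x⁻¹ ∈ Ioo ρ 1 := by
        refine ⟨?_, by linarith [inv_pos.2 hx0]⟩
        have := inv_strictAnti₀ hXpos h
        rw [hX, inv_inv] at this
        linarith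
      have h3 : ‖(f (((1 - x⁻¹ : ℝ) : ℂ) * ζ))⁻¹‖ ≤ Real.exp (ε / 2 / (1 - (1 - x⁻¹))) :=
        hρ hxρ
      rw [sub_sub_cancel, div_inv_eq_mul] at h3
      have h4 : x ≤ 2 / ε * Real.exp (ε / 2 * x) := by
        have := Real.add_one_le_exp (ε / 2 * x)
        calc x = 2 / ε * (ε / 2 * x) := by field_simp
          _ ≤ _ := by gcongr; linarith
      calc C * x * ‖(f (((1 - x⁻¹ : ℝ) : ℂ) * ζ))⁻¹‖
          ≤ C * (2 / ε * Real.exp (ε / 2 * x)) * Real.exp (ε / 2 * x) := by gcongr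
        _ = C * (2 / ε) * Real.exp (ε * x) := by
          rw [mul_assoc, mul_assoc, ← Real.exp_add, ← mul_assoc]
          congr 2
          ring
        _ ≤ _ := by
          gcongr
          exact le_add_of_nonneg_right (by positivity)

end LinearResolvent

theorem tendsto_algNorm_zero {μ : Measure ℂ} [IsFiniteMeasure μ] (hμ : OnCircle μ)
    {F : ℕ → ℂ → ℂ} {δ : ℕ → ℝ} {C : ℝ} (hδ : Tendsto δ atTop (𝓝 0))
    (hF : ∀ n, ∀ z ∈ disc, ‖F n z‖ ≤ δ n) (hC : ∀ n, ∀ z ∈ disc, ‖deriv (F n) z‖ ≤ C)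
    (hd : ∀ z ∈ disc, Tendsto (fun n => deriv (F n) z) atTop (𝓝 0)) :
    Tendsto (fun n => algNorm μ (F n)) atTop (𝓝 0) := by
  have h1 : Tendsto (fun n => supNorm (F n)) atTop (𝓝 0) :=
    squeeze_zero (fun n => supNorm_nonneg _) (fun n => supNorm_le (hF n)) hδ
  have h2 : Tendsto (fun n => ∫ z in disc, dirichletDensity μ (F n) z) atTop
      (𝓝 (∫ _ in disc, (0 : ℝ))) := by
    refine tendsto_integral_of_dominated_convergence (fun z => C ^ 2 * poissonMu μ z)
      (fun n => aestronglyMeasurable_dirichletDensity hμ _)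
      ((integrableOn_poissonMu μ hμ).const_mul _) (fun n => ?_) ?_
    · filter_upwards [ae_restrict_mem measurableSet_ball] with z hz
      rw [Real.norm_of_nonneg (dirichletDensity_nonneg μ _ hz)]
      have := poissonMu_nonneg μ hz
      unfold dirichletDensity
      gcongr
      exact hC n z hz
    · filter_upwards [ae_restrict_mem measurableSet_ball] with z hz
      simpa [dirichletDensity] using ((hd z hz).norm.pow 2).mul_const (poissonMu μ z)
  have h3 := (h2.const_mul (1 / Real.pi)).sqrt
  rw [integral_zero, mul_zero, Real.sqrt_zero] at h3
  simpa [algNorm, dirichletIntegral] using h1.add h3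

theorem memA_sub_const_pow {μ : Measure ℂ} [IsFiniteMeasure μ] (hμ : OnCircle μ) (ζ : ℂ)
    (n : ℕ) : MemA μ (fun z => (z - ζ) ^ n) := by
  induction n with
  | zero => simpa using memA_const hμ 1
  | succ n ih =>
    simpa only [pow_succ, sub_eq_add_neg] using
      (memA_mul hμ ih (memA_add hμ (memA_id hμ) (memA_const hμ (-ζ))).1).1

/-- A repeated boundary zero can be replaced by a zero just outside the disc. -/
theorem ClosedIdeal.pow_mem_of_pow_succ_mem {μ : Measure ℂ} [IsFiniteMeasure μ]
    (hμ : OnCircle μ) {J : Set (ℂ → ℂ)} (hJ : ClosedIdeal μ J) {ζ : ℂ} (hζ : ‖ζ‖ = 1) {m : ℕ}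
    (h : (fun z => (z - ζ) ^ (m + 2)) ∈ J) : (fun z => (z - ζ) ^ (m + 1)) ∈ J := by
  set ε : ℕ → ℝ := fun n => 1 / ((n : ℝ) + 1) with hε
  have hε0 : ∀ n, 0 < ε n := fun n => by positivity
  have hεt : Tendsto ε atTop (𝓝 0) := tendsto_one_div_add_atTop_nhds_zero_nat
  set v : ℕ → ℂ → ℂ := fun n z => -((1 + ε n : ℝ) * ζ) + 1 * z with hv
  have hnorm : ∀ n, ‖-(((1 + ε n : ℝ) : ℂ) * ζ)‖ = 1 + ε n := fun n => by
    rw [norm_neg, norm_mul, hζ, mul_one, norm_real,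
      Real.norm_of_nonneg (by linarith [hε0 n])]
  have hvlow : ∀ n z, z ∈ disc → ε n + (1 - ‖z‖) ≤ ‖v n z‖ := fun n z _ => by
    have h1 := norm_sub_norm_le (-(((1 + ε n : ℝ) : ℂ) * ζ)) (-z)
    rw [hnorm, norm_neg, sub_neg_eq_add] at h1
    simp only [hv, one_mul]
    linarith
  have hvpos : ∀ n z, z ∈ disc → 0 < ‖v n z‖ := fun n z hz => by
    linarith [hvlow n z hz, hε0 n, mem_disc.1 hz]
  have hw : ∀ n z, z - ζ = v n z + ε n * ζ := fun n z => by
    simp only [hv]; push_cast; ring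
  have hw2 : ∀ z ∈ disc, ‖z - ζ‖ ≤ 2 := fun z hz => by
    linarith [norm_sub_le z ζ, mem_disc.1 hz]
  have hwv : ∀ n z, z ∈ disc → ‖z - ζ‖ ≤ 2 * ‖v n z‖ := fun n z hz => by
    have h1 : ‖(ε n : ℂ) * ζ‖ = ε n := by
      rw [norm_mul, hζ, mul_one, norm_real, Real.norm_of_nonneg (hε0 n).le]
    have h2 := norm_add_le (v n z) (ε n * ζ)
    rw [← hw, h1] at h2
    linarith [hvlow n z hz, mem_disc.1 hz]
  have hkJ : ∀ n, (fun z => (v n z)⁻¹ * (z - ζ) ^ (m + 2)) ∈ J := fun n =>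
    hJ.mul_mem _ (memA_inv_linear hμ (by rw [hnorm, norm_one]; linarith [hε0 n])).1 _ h
  set F : ℕ → ℂ → ℂ := fun n z => -(ε n * ζ) * ((z - ζ) ^ (m + 1) * (v n z)⁻¹) with hF
  have hFeq : ∀ n z, z ∈ disc →
      (z - ζ) ^ (m + 1) - (v n z)⁻¹ * (z - ζ) ^ (m + 2) = F n z := fun n z hz => by
    have h0 := norm_pos_iff.1 (hvpos n z hz)
    have h1 : (ε n : ℂ) * ζ = (z - ζ) - v n z := by rw [hw n z]; ring
    simp only [hF, h1]
    field_simp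
    ring
  have hderiv : ∀ n z, z ∈ disc → ‖deriv (F n) z‖ ≤ ε n * ((m + 3) * 2 ^ m) / ‖v n z‖ :=
    fun n z hz => by
      have h0 := norm_pos_iff.1 (hvpos n z hz)
      have hp := hvpos n z hz
      have h1 : HasDerivAt (v n) 1 z := by
        simpa [hv] using ((hasDerivAt_id z).const_mul 1).const_add (-((1 + ε n : ℝ) * ζ))
      have h2 : HasDerivAt (fun z => (z - ζ) ^ (m + 1)) ((m + 1 : ℕ) * (z - ζ) ^ m) z := by
        simpa using ((hasDerivAt_id z).sub_const ζ).fun_pow (m + 1)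
      have h3 := ((h2.mul (h1.inv h0)).const_mul (-(ε n * ζ)))
      rw [show deriv (F n) z = _ from h3.deriv]
      have h4 : ‖(ε n : ℂ) * ζ‖ = ε n := by
        rw [norm_mul, hζ, mul_one, norm_real, Real.norm_of_nonneg (hε0 n).le]
      have h5 : ‖((m + 1 : ℕ) : ℂ) * (z - ζ) ^ m * (v n z)⁻¹‖ ≤
          (m + 1) * 2 ^ m / ‖v n z‖ := by
        rw [norm_mul, norm_mul, norm_inv, norm_pow, Complex.norm_natCast, ← div_eq_mul_inv]
        push_cast
        gcongr
        exact hw2 z hz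
      have h6 : ‖(z - ζ) ^ (m + 1) * (-1 / v n z ^ 2)‖ ≤ 2 * 2 ^ m / ‖v n z‖ := by
        rw [norm_mul, norm_div, norm_neg, norm_one, norm_pow, norm_pow, pow_succ,
          mul_one_div, div_le_div_iff₀ (by positivity) hp]
        calc ‖z - ζ‖ ^ m * ‖z - ζ‖ * ‖v n z‖ ≤ 2 ^ m * (2 * ‖v n z‖) * ‖v n z‖ := by
              gcongr
              exacts [hw2 z hz, hwv n z hz]
          _ = _ := by ring
      rw [norm_mul, norm_neg, h4, mul_div_assoc]
      refine mul_le_mul_of_nonneg_left ((norm_add_le _ _).trans ((add_le_add h5 h6).trans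
        (le_of_eq ?_))) (hε0 n).le
      ring
  have hlim : Tendsto (fun n => algNorm μ (F n)) atTop (𝓝 0) := by
    refine tendsto_algNorm_zero hμ (δ := fun n => ε n * (2 * 2 ^ m)) (C := (m + 3) * 2 ^ m)
      (by simpa using hεt.mul_const (2 * 2 ^ m)) (fun n z hz => ?_) (fun n z hz => ?_)
      (fun z hz => ?_)
    · have hp := hvpos n z hz
      simp only [hF]
      rw [norm_mul, norm_neg, norm_mul, hζ, mul_one, norm_real,
        Real.norm_of_nonneg (hε0 n).le, norm_mul, norm_inv, norm_pow, pow_succ,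
        ← div_eq_mul_inv]
      refine mul_le_mul_of_nonneg_left ?_ (hε0 n).le
      rw [div_le_iff₀ hp]
      calc ‖z - ζ‖ ^ m * ‖z - ζ‖ ≤ 2 ^ m * (2 * ‖v n z‖) := by
            gcongr
            exacts [hw2 z hz, hwv n z hz]
        _ = _ := by ring
    · refine (hderiv n z hz).trans ?_
      rw [div_le_iff₀ (hvpos n z hz), mul_comm]
      gcongr
      linarith [hvlow n z hz, mem_disc.1 hz]
    · have h1 : 0 < 1 - ‖z‖ := by linarith [mem_disc.1 hz]
      refine squeeze_zero_norm (a := fun n => ε n * ((m + 3) * 2 ^ m) / (1 - ‖z‖))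
        (fun n => (hderiv n z hz).trans ?_) ?_
      · have := (hε0 n).le
        gcongr
        linarith [hvlow n z hz]
      · simpa using (hεt.mul_const (((m : ℝ) + 3) * 2 ^ m)).div_const (1 - ‖z‖)
  refine hJ.closed _ (memA_sub_const_pow hμ ζ _) fun η hη => ?_
  obtain ⟨n, hn⟩ := (hlim.eventually_lt_const hη).exists
  exact ⟨_, hkJ n, (algNorm_congr (hFeq n)).trans_lt hn⟩

/-- If a closed ideal `J` of `D(μ) ∩ H^∞` contains an outer function and
`Z̲(J) = {ζ₀}` with `ζ₀ ∈ 𝕋`, then `z - ζ₀ ∈ J`. -/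
theorem ideal_contains_linear_factor
    (μ : Measure ℂ) [IsFiniteMeasure μ] (hμ : OnCircle μ)
    (J : Set (ℂ → ℂ)) (hJ : ClosedIdeal μ J)
    (hout : ∃ f ∈ J, IsOuter f)
    (ζ₀ : ℂ) (hζ₀ : ζ₀ ∈ circleT) (hZ : ZlowSet J = {ζ₀}) :
    (fun z => z - ζ₀) ∈ J := by
  have hζ : ‖ζ₀‖ = 1 := mem_sphere_zero_iff_norm.1 hζ₀
  have hζ0 : ζ₀ ≠ 0 := fun h => by simp [h] at hζ
  obtain ⟨B, _, _, _, π, hπ, hker⟩ := hJ.exists_representation hμ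
  have h1 : π (linearFactor hμ ζ₀ ^ 4) = 0 := by
    rw [map_pow]
    refine linearFactor_pow_four hπ hker hJ hout hζ fun w _ hw => ?_
    have hw' : w ∉ ZlowSet J := by rwa [hZ, mem_singleton_iff]
    simpa [ZlowSet] using hw'
  have h2 := hJ.mul_mem _ (memA_const hμ (ζ₀ ^ 4)) _ ((hker _).1 h1)
  have h3 : (fun z => (z - ζ₀) ^ (2 + 2)) ∈ J := by
    convert h2 using 2 with z
    change (z - ζ₀) ^ 4 = ζ₀ ^ 4 * (1 + -ζ₀⁻¹ * z) ^ 4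
    rw [← mul_pow, mul_add, ← mul_assoc, mul_neg, mul_inv_cancel₀ hζ0]
    ring
  simpa using hJ.pow_mem_of_pow_succ_mem hμ hζ (m := 0)
    (hJ.pow_mem_of_pow_succ_mem hμ hζ (hJ.pow_mem_of_pow_succ_mem hμ hζ h3))

end DirichletMu
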